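/- arXiv:0707.2169 — 2 statements merged into one kernel-verified Lean document; each statement's English description precedes it below -/
import Mathlib

section
/- Let v ∈ C¹(Ω) be a positive weak solution of Q'(u) = 0 in Ω and let w ∈ C¹(Ω) be nonnegative with compact support in Ω. Then Q(vw) ≍ ∫_Ω v²|∇w|²(w|∇v| + v|∇w|)^{p−2} dx, where the constants in ≍ depend only on p. In particular, if p ≥ 2, then Q(vw) ≍ ∫_Ω (v^p|∇w|^p + v²|∇v|^{p−2}w^{p−2}|∇w|²) dx. -/
open MeasureTheory Filter Set Metric
open scoped RealInnerProductSpace Topology NNReal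

noncomputable section

abbrev Ed (d : ℕ) : Type := EuclideanSpace ℝ (Fin d)

/-- `u ∈ C_c^∞(Ω)`: a smooth function compactly supported inside `Ω`. -/
def IsTestFun {d : ℕ} (Ω : Set (Ed d)) (u : Ed d → ℝ) : Prop :=
  ContDiff ℝ (⊤ : ℕ∞) u ∧ HasCompactSupport u ∧ tsupport u ⊆ Ω

/-- `V ∈ L^∞_loc(Ω)`. -/
def LinfLoc {d : ℕ} (Ω : Set (Ed d)) (V : Ed d → ℝ) : Prop :=
  Measurable V ∧ ∀ K : Set (Ed d), IsCompact K → K ⊆ Ω → ∃ C : ℝ, ∀ x ∈ K, |V x| ≤ C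

/-- The energy functional `Q(u) = (1/p) ∫_Ω (|∇u|^p + V|u|^p)`. -/
def Qf {d : ℕ} (p : ℝ) (V : Ed d → ℝ) (Ω : Set (Ed d)) (u : Ed d → ℝ) : ℝ :=
  (1 / p) * ∫ x in Ω, (‖gradient u x‖ ^ p + V x * |u x| ^ p)

/-- Weak solution of `Q'(u) = -Δ_p u + V|u|^{p-2}u = 0` in `Ω'`. -/
def IsSolution {d : ℕ} (p : ℝ) (V : Ed d → ℝ) (Ω' : Set (Ed d)) (v : Ed d → ℝ) : Prop :=
  ∀ φ : Ed d → ℝ, IsTestFun Ω' φ →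
    ∫ x in Ω', (‖gradient v x‖ ^ (p - 2) * ⟪gradient v x, gradient φ x⟫
      + V x * |v x| ^ (p - 2) * v x * φ x) = 0

/-- Weak supersolution of `Q'(u) = 0` in `Ω'`. -/
def IsSupersolution {d : ℕ} (p : ℝ) (V : Ed d → ℝ) (Ω' : Set (Ed d)) (v : Ed d → ℝ) : Prop :=
  ∀ φ : Ed d → ℝ, IsTestFun Ω' φ → (∀ x, 0 ≤ φ x) →
    0 ≤ ∫ x in Ω', (‖gradient v x‖ ^ (p - 2) * ⟪gradient v x, gradient φ x⟫
      + V x * |v x| ^ (p - 2) * v x * φ x)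

/-- Weak subsolution of `Q'(u) = 0` in `Ω'`. -/
def IsSubsolution {d : ℕ} (p : ℝ) (V : Ed d → ℝ) (Ω' : Set (Ed d)) (v : Ed d → ℝ) : Prop :=
  ∀ φ : Ed d → ℝ, IsTestFun Ω' φ → (∀ x, 0 ≤ φ x) →
    ∫ x in Ω', (‖gradient v x‖ ^ (p - 2) * ⟪gradient v x, gradient φ x⟫
      + V x * |v x| ^ (p - 2) * v x * φ x) ≤ 0

theorem one_sub_rpow_le {α u : ℝ} (hα : 0 < α) (hu0 : 0 ≤ u) (hu1 : u ≤ 1) :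
    1 - u ^ α ≤ max 1 α * (1 - u) := by
  rcases le_total 1 α with h | h
  · have := one_add_mul_self_le_rpow_one_add (s := u - 1) (by linarith) h
    rw [max_eq_right h]
    have e : 1 + (u - 1) = u := by ring
    rw [e] at this
    linarith
  · rw [max_eq_left h]
    have := Real.rpow_le_rpow_of_exponent_ge' hu0 hu1 hα.le h
    rw [Real.rpow_one] at this
    linarith

theorem rpow_le_one_add {α u : ℝ} (hα : 0 ≤ α) (hα1 : α ≤ 1) (hu0 : 0 ≤ u) :
    u ^ α ≤ 1 - α * (1 - u) := by
  have := rpow_one_add_le_one_add_mul_self (s := u - 1) (by linarith) hα hα1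
  have e : 1 + (u - 1) = u := by ring
  rw [e] at this
  linarith

/-- Lower bound for the Bregman divergence of `t ↦ t ^ p` between `1` and `u`. -/
theorem bregman_one_left_lower {p u : ℝ} (hp : 1 < p) (hu0 : 0 ≤ u) (hu1 : u ≤ 1) :
    min 1 ((p - 1) ^ 2) * (1 - u) ^ 2 ≤ 1 - u ^ p - p * u ^ (p - 1) * (1 - u) := by
  rcases hu0.eq_or_lt with rfl | hu
  · rw [Real.zero_rpow (by linarith), Real.zero_rpow (by linarith)]
    have := min_le_left 1 ((p - 1) ^ 2)
    linarith
  have e1 : u ^ p = u ^ (p - 1) * u := by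
    rw [Real.rpow_sub_one hu.ne']; field_simp
  rcases le_total p 2 with h | h
  · have h1 := rpow_le_one_add (α := p - 1) (by linarith) (by linarith) hu0
    have h2 : min 1 ((p - 1) ^ 2) * (1 - u) ^ 2 ≤ (p - 1) ^ 2 * (1 - u) ^ 2 := by
      gcongr; exact min_le_right _ _
    have h3 := mul_le_mul_of_nonneg_right h1 (show 0 ≤ p - (p - 1) * u by nlinarith)
    rw [e1]
    nlinarith
  · have h2 : min 1 ((p - 1) ^ 2) * (1 - u) ^ 2 ≤ 1 * (1 - u) ^ 2 := by
      gcongr; exact min_le_left _ _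
    have e2 : u ^ (p - 1) = u ^ (p - 2) * u := by
      rw [← Real.rpow_add_one hu.ne']; congr 1; ring
    have h3 : u ^ (p - 2) * (1 + (p - 2) * (1 - u)) ≤ 1 := by
      have k1 : 1 + (p - 2) * (1 - u) ≤ Real.exp ((p - 2) * (1 - u)) := by
        linarith [Real.add_one_le_exp ((p - 2) * (1 - u))]
      have k2 : u ^ (p - 2) ≤ Real.exp ((u - 1) * (p - 2)) := by
        rw [Real.exp_mul]
        apply Real.rpow_le_rpow hu0 _ (by linarith)
        linarith [Real.add_one_le_exp (u - 1)]
      calc _ ≤ Real.exp ((u - 1) * (p - 2)) * Real.exp ((p - 2) * (1 - u)) := by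
            gcongr
        _ = 1 := by rw [← Real.exp_add, ← Real.exp_zero]; congr 1; ring
    have h4 : 0 ≤ u ^ (p - 2) := by positivity
    have h5 : u ^ (p - 2) * (2 - u + (p - 2) * (1 - u)) ≤ 2 - u := by
      have : u ^ (p - 2) * (2 - u + (p - 2) * (1 - u)) ≤
          (2 - u) * (u ^ (p - 2) * (1 + (p - 2) * (1 - u))) := by
        have : 0 ≤ u ^ (p - 2) * ((p - 2) * (1 - u) * (1 - u)) := by
          apply mul_nonneg h4
          apply mul_nonneg (mul_nonneg _ _) <;> linarith
        nlinarith
      nlinarith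
    have h6 := mul_le_mul_of_nonneg_right h5 hu0
    rw [e1, e2]
    nlinarith

/-- Lower bound for the Bregman divergence of `t ↦ t ^ p` between `u` and `1`. -/
theorem bregman_one_right_lower {p u : ℝ} (hp : 1 < p) (hu0 : 0 ≤ u) (hu1 : u ≤ 1) :
    min 1 ((p - 1) ^ 2) * (1 - u) ^ 2 ≤ u ^ p - 1 + p * (1 - u) := by
  rcases hu0.eq_or_lt with rfl | hu
  · rw [Real.zero_rpow (by linarith)]
    rcases le_total p 2 with h | h
    · have := min_le_right 1 ((p - 1) ^ 2)
      nlinarith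
    · have := min_le_left 1 ((p - 1) ^ 2)
      linarith
  rcases le_total p 2 with h | h
  · have h2 : min 1 ((p - 1) ^ 2) * (1 - u) ^ 2 ≤ (p - 1) ^ 2 * (1 - u) ^ 2 := by
      gcongr; exact min_le_right _ _
    have h1 := rpow_le_one_add (α := 2 - p) (by linarith) (by linarith) hu0
    have e : u ^ p * u ^ (2 - p) = u ^ 2 := by
      rw [← Real.rpow_add hu]; norm_num
    have h3 : 0 < 1 - (2 - p) * (1 - u) := by nlinarith
    have h4 : u ^ 2 ≤ u ^ p * (1 - (2 - p) * (1 - u)) := by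
      rw [← e]; gcongr
    have h5 : (1 - p * (1 - u) + (p - 1) ^ 2 * (1 - u) ^ 2) * (1 - (2 - p) * (1 - u)) ≤ u ^ 2 := by
      have : 0 ≤ (2 - p) * (p - 1) ^ 2 * (1 - u) ^ 3 := by
        apply mul_nonneg (mul_nonneg _ _) _
        · linarith
        · positivity
        · have : 0 ≤ 1 - u := by linarith
          positivity
      nlinarith
    have h6 := le_of_mul_le_mul_right (h5.trans h4) h3
    linarith
  · have h2 : min 1 ((p - 1) ^ 2) * (1 - u) ^ 2 ≤ 1 * (1 - u) ^ 2 := by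
      gcongr; exact min_le_left _ _
    have := one_add_mul_self_le_rpow_one_add (s := u ^ 2 - 1) (by nlinarith) (p := p / 2)
      (by linarith)
    have e : (1 + (u ^ 2 - 1)) ^ (p / 2) = u ^ p := by
      rw [show 1 + (u ^ 2 - 1) = u ^ (2 : ℝ) by norm_num, ← Real.rpow_mul hu0]
      congr 1; ring
    rw [e] at this
    nlinarith

theorem bregman_one_sum_upper {p u : ℝ} (hp : 1 < p) (hu0 : 0 ≤ u) (hu1 : u ≤ 1) :
    p * (1 - u ^ (p - 1)) * (1 - u) ≤ p * max 1 (p - 1) * (1 - u) ^ 2 := by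
  have := one_sub_rpow_le (α := p - 1) (by linarith) hu0 hu1
  have h2 := mul_le_mul_of_nonneg_right this (show 0 ≤ p * (1 - u) by nlinarith)
  nlinarith

/-- The Bregman divergence of `t ↦ t ^ p` on the half-line is comparable to
`(r - s) ^ 2 * max r s ^ (p - 2)`. -/
theorem bregman_half_line {p r s : ℝ} (hp : 1 < p) (hr : 0 ≤ r) (hs : 0 ≤ s) :
    min 1 ((p - 1) ^ 2) * ((r - s) ^ 2 * max r s ^ (p - 2)) ≤
        r ^ p - s ^ p - p * s ^ (p - 1) * (r - s) ∧
      r ^ p - s ^ p - p * s ^ (p - 1) * (r - s) ≤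
        p * max 1 (p - 1) * ((r - s) ^ 2 * max r s ^ (p - 2)) := by
  have hc : 0 ≤ min 1 ((p - 1) ^ 2) := by positivity
  have sub2 : ∀ {x : ℝ}, 0 < x → x ^ (p - 2) = x ^ p / x ^ 2 := fun {x} hx => by
    rw [Real.rpow_sub hx]; norm_num
  have mulu : ∀ {u : ℝ}, 0 ≤ u → u ^ (p - 1) * u = u ^ p := fun {u} hu => by
    rcases hu.eq_or_lt with rfl | hu
    · rw [Real.zero_rpow (by linarith : p ≠ 0)]; simp
    · rw [← Real.rpow_add_one hu.ne']; congr 1; ring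
  rcases le_total s r with h | h
  · rcases hr.eq_or_lt with rfl | hr
    · obtain rfl : s = 0 := le_antisymm h hs
      simp
    obtain ⟨u, rfl⟩ : ∃ u, s = r * u := ⟨s / r, by field_simp⟩
    have hu0 : 0 ≤ u := nonneg_of_mul_nonneg_right hs hr
    have hu1 : u ≤ 1 := by nlinarith
    have h1 := bregman_one_left_lower hp hu0 hu1
    have h2 := bregman_one_sum_upper hp hu0 hu1
    have h3 := bregman_one_right_lower hp hu0 hu1
    have hrp : 0 < r ^ p := by positivity
    have e1 : (r - r * u) ^ 2 * r ^ (p - 2) = r ^ p * (1 - u) ^ 2 := by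
      rw [sub2 hr]; field_simp
    have e2 : r ^ p - (r * u) ^ p - p * (r * u) ^ (p - 1) * (r - r * u) =
        r ^ p * (1 - u ^ p - p * u ^ (p - 1) * (1 - u)) := by
      rw [Real.mul_rpow hr.le hu0, Real.mul_rpow hr.le hu0, ← mulu hr.le]; ring
    rw [max_eq_left h, e1, e2]
    constructor
    · nlinarith
    · have h4 : 0 ≤ min 1 ((p - 1) ^ 2) * (1 - u) ^ 2 := by positivity
      have := mulu hu0
      have h5 : 1 - u ^ p - p * u ^ (p - 1) * (1 - u) ≤ p * max 1 (p - 1) * (1 - u) ^ 2 := by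
        nlinarith
      nlinarith
  · rcases hs.eq_or_lt with rfl | hs
    · obtain rfl : r = 0 := le_antisymm h hr
      simp
    obtain ⟨u, rfl⟩ : ∃ u, r = s * u := ⟨r / s, by field_simp⟩
    have hu0 : 0 ≤ u := nonneg_of_mul_nonneg_right hr hs
    have hu1 : u ≤ 1 := by nlinarith
    have h1 := bregman_one_left_lower hp hu0 hu1
    have h2 := bregman_one_sum_upper hp hu0 hu1
    have h3 := bregman_one_right_lower hp hu0 hu1
    have hrp : 0 < s ^ p := by positivity
    have e1 : (s * u - s) ^ 2 * s ^ (p - 2) = s ^ p * (1 - u) ^ 2 := by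
      rw [sub2 hs]; field_simp; ring
    have e2 : (s * u) ^ p - s ^ p - p * s ^ (p - 1) * (s * u - s) =
        s ^ p * (u ^ p - 1 + p * (1 - u)) := by
      rw [Real.mul_rpow hs.le hu0, ← mulu hs.le]; ring
    rw [max_eq_right h, e1, e2]
    constructor
    · nlinarith
    · have h4 : 0 ≤ min 1 ((p - 1) ^ 2) * (1 - u) ^ 2 := by positivity
      have := mulu hu0
      have h5 : u ^ p - 1 + p * (1 - u) ≤ p * max 1 (p - 1) * (1 - u) ^ 2 := by
        nlinarith
      nlinarith

/-- Adding the angular term to the radial Bregman divergence. Here `r = ‖a + b‖`, `s = ‖a‖` and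
`m = ‖a‖ * ‖a + b‖ - ⟪a, a + b⟫`. -/
theorem bregman_add_angular {p : ℝ} (hp : 1 < p) :
    ∃ K : ℝ, 1 ≤ K ∧ ∀ r s m : ℝ, 0 ≤ r → 0 ≤ s → 0 ≤ m → m ≤ 2 * (s * r) →
      ((r - s) ^ 2 + 2 * m) * max r s ^ (p - 2) ≤
          K * (r ^ p - s ^ p - p * s ^ (p - 1) * (r - s) + p * s ^ (p - 2) * m) ∧
        r ^ p - s ^ p - p * s ^ (p - 1) * (r - s) + p * s ^ (p - 2) * m ≤
          K * (((r - s) ^ 2 + 2 * m) * max r s ^ (p - 2)) := by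
  set c := min 1 ((p - 1) ^ 2) with hc
  set C := p * max 1 (p - 1) with hC
  have hc0 : 0 < c := lt_min one_pos (by nlinarith)
  have hC0 : 1 ≤ C := by nlinarith [le_max_left 1 (p - 1)]
  set A : ℝ := 2 ^ |p - 2| with hA
  have hA1 : 1 ≤ A := Real.one_le_rpow (by norm_num) (abs_nonneg _)
  refine ⟨9 * c⁻¹ + 2 * A + C + 8 * p + p * A, ?_, ?_⟩
  · have := inv_pos.2 hc0
    nlinarith
  intro r s m hr hs hm hms
  obtain ⟨h1, h2⟩ := bregman_half_line hp hr hs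
  rw [← hc] at h1
  rw [← hC] at h2
  set B := r ^ p - s ^ p - p * s ^ (p - 1) * (r - s)
  set P := max r s ^ (p - 2) with hP
  have hM0 : 0 ≤ max r s := hr.trans (le_max_left _ _)
  have hP0 : 0 ≤ P := by positivity
  set G := (r - s) ^ 2 * P with hG
  have hG0 : 0 ≤ G := by positivity
  have hci : 0 < c⁻¹ := inv_pos.2 hc0
  have hB0 : 0 ≤ B := le_trans (by positivity) h1
  have hsm0 : 0 ≤ s ^ (p - 2) * m := by positivity
  have hGB : G ≤ c⁻¹ * B := by
    rw [inv_mul_eq_div, le_div_iff₀ hc0]; linarith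
  have hmP : 0 ≤ m * P := by positivity
  -- the two bounds on the angular term
  suffices hlow : m * P ≤ A * (s ^ (p - 2) * m) + 4 * G by
    suffices hup : s ^ (p - 2) * m ≤ A * (m * P) + 8 * G by
      have e : ((r - s) ^ 2 + 2 * m) * P = G + 2 * (m * P) := by rw [hG]; ring
      rw [e, mul_assoc p]
      have hp0 : 0 < p := by linarith
      have k1 : 0 ≤ (2 * A + C + 8 * p + p * A) * B := by positivity
      have k2 : 0 ≤ (9 * c⁻¹ + C + 8 * p + p * A) * (p * (s ^ (p - 2) * m)) := by positivity
      have k3 : 2 * A * (s ^ (p - 2) * m) ≤ 2 * A * (p * (s ^ (p - 2) * m)) := by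
        exact mul_le_mul_of_nonneg_left (le_mul_of_one_le_left hsm0 hp.le) (by positivity)
      have k4 : 0 ≤ (9 * c⁻¹ + 2 * A + p * A) * G := by positivity
      have k5 : 0 ≤ (9 * c⁻¹ + 2 * A + C + 8 * p) * (m * P) := by positivity
      have k6 := mul_le_mul_of_nonneg_left hup hp0.le
      have k7 : 0 ≤ p * A * (m * P) := by positivity
      constructor <;> linarith
    rcases hm.eq_or_lt with rfl | hm
    · simp only [mul_zero, zero_mul, zero_add]; positivity
    have hs' : 0 < s := hs.lt_of_ne' (by rintro rfl; linarith)
    have hM : 0 < max r s := hs'.trans_le (le_max_right _ _)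
    rcases le_total 2 p with h | h
    · have : s ^ (p - 2) ≤ P := Real.rpow_le_rpow hs (le_max_right _ _) (by linarith)
      nlinarith [mul_le_mul_of_nonneg_right this hm.le]
    rcases le_total r (2 * s) with h' | h'
    · have : s ^ (p - 2) ≤ A * P := by
        rw [hA, abs_of_nonpos (by linarith), Real.rpow_neg (by norm_num),
          ← Real.inv_rpow (by norm_num), hP, ← Real.mul_rpow (by norm_num) hM0]
        apply Real.rpow_le_rpow_of_nonpos (by positivity) _ (by linarith)
        have : max r s ≤ 2 * s := max_le h' (by linarith)
        linarith
      nlinarith [mul_le_mul_of_nonneg_right this hm.le]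
    · have hr' : 0 < r := by linarith
      have hMr : max r s = r := max_eq_left (by linarith)
      have k1 : s ^ (p - 2) * m ≤ 2 * (s ^ (p - 1) * r) := by
        have : s ^ (p - 1) = s ^ (p - 2) * s := by
          rw [← Real.rpow_add_one hs'.ne']; congr 1; ring
        rw [this]
        have := mul_le_mul_of_nonneg_left hms (show 0 ≤ s ^ (p - 2) by positivity)
        linarith
      have k2 : s ^ (p - 1) * r ≤ r ^ 2 * P := by
        have e : r ^ 2 * P = r ^ (p - 1) * r := by
          rw [hP, hMr, show p - 1 = p - 2 + 1 by ring, Real.rpow_add_one hr'.ne']; ring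
        rw [e]
        gcongr
        linarith
      have k3 : r ^ 2 * P ≤ 4 * G := by
        have : r ^ 2 ≤ 4 * (r - s) ^ 2 := by nlinarith
        have := mul_le_mul_of_nonneg_right this hP0
        linarith
      have : 0 ≤ A * (m * P) := by positivity
      linarith
  rcases hm.eq_or_lt with rfl | hm
  · simp only [mul_zero, zero_mul, zero_add]; positivity
  have hs' : 0 < s := hs.lt_of_ne' (by rintro rfl; linarith)
  rcases le_total 2 p with h | h
  · rcases le_total r (2 * s) with h' | h'
    · have : P ≤ A * s ^ (p - 2) := by
        rw [hA, abs_of_nonneg (by linarith), hP, ← Real.mul_rpow (by norm_num) hs]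
        apply Real.rpow_le_rpow hM0 _ (by linarith)
        exact max_le h' (by linarith)
      nlinarith [mul_le_mul_of_nonneg_right this hm.le]
    · have : m ≤ 4 * (r - s) ^ 2 := by nlinarith
      have := mul_le_mul_of_nonneg_right this hP0
      have : 0 ≤ A * (s ^ (p - 2) * m) := by positivity
      linarith
  · have : P ≤ s ^ (p - 2) :=
      Real.rpow_le_rpow_of_nonpos hs' (le_max_right _ _) (by linarith)
    have := mul_le_mul_of_nonneg_right this hm.le
    nlinarith

theorem rpow_le_three_rpow_mul {x y q : ℝ} (hx : 0 < x) (hy : 0 < y) (hxy : x ≤ 3 * y)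
    (hyx : y ≤ 3 * x) : x ^ q ≤ 3 ^ |q| * y ^ q := by
  rcases le_total 0 q with h | h
  · rw [abs_of_nonneg h, ← Real.mul_rpow (by norm_num) hy.le]
    exact Real.rpow_le_rpow hx.le hxy h
  · rw [abs_of_nonpos h, Real.rpow_neg (by norm_num), ← Real.inv_rpow (by norm_num),
      ← Real.mul_rpow (by norm_num) hy.le]
    exact Real.rpow_le_rpow_of_nonpos (by positivity) (by linarith) h

/-- The Bregman divergence of `‖·‖ ^ p` is comparable to `‖b‖ ^ 2 * (‖a‖ + ‖b‖) ^ (p - 2)`, with a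
constant depending only on `p`. -/
theorem bregman_norm_rpow {p : ℝ} (hp : 1 < p) :
    ∃ K : ℝ, 1 ≤ K ∧ ∀ (d : ℕ) (a b : Ed d),
      ‖b‖ ^ (2 : ℝ) * (‖a‖ + ‖b‖) ^ (p - 2) ≤
          K * (‖a + b‖ ^ p - ‖a‖ ^ p - p * (‖a‖ ^ (p - 2) * inner ℝ a b)) ∧
        ‖a + b‖ ^ p - ‖a‖ ^ p - p * (‖a‖ ^ (p - 2) * inner ℝ a b) ≤
          K * (‖b‖ ^ (2 : ℝ) * (‖a‖ + ‖b‖) ^ (p - 2)) := by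
  obtain ⟨K, hK, H⟩ := bregman_add_angular hp
  have hL : (1 : ℝ) ≤ 3 ^ |p - 2| := Real.one_le_rpow (by norm_num) (abs_nonneg _)
  refine ⟨3 ^ |p - 2| * K, by nlinarith, fun d a b => ?_⟩
  rcases eq_or_ne b 0 with rfl | hb
  · simp
  have hb' : 0 < ‖b‖ := norm_pos_iff.2 hb
  have hin : |inner ℝ a (a + b)| ≤ ‖a‖ * ‖a + b‖ := abs_real_inner_le_norm _ _
  obtain ⟨h1, h2⟩ := H ‖a + b‖ ‖a‖ (‖a‖ * ‖a + b‖ - inner ℝ a (a + b)) (norm_nonneg _) (norm_nonneg _)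
    (by linarith [le_abs_self (inner ℝ a (a + b))]) (by linarith [neg_abs_le (inner ℝ a (a + b))])
  have e0 : inner ℝ a (a + b) = ‖a‖ ^ 2 + inner ℝ a b := by
    rw [inner_add_right, real_inner_self_eq_norm_sq]
  have e1 : (‖a + b‖ - ‖a‖) ^ 2 + 2 * (‖a‖ * ‖a + b‖ - inner ℝ a (a + b)) = ‖b‖ ^ 2 := by
    have := norm_add_sq_real a b
    rw [e0]; linarith
  have e2 : ‖a + b‖ ^ p - ‖a‖ ^ p - p * ‖a‖ ^ (p - 1) * (‖a + b‖ - ‖a‖) +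
      p * ‖a‖ ^ (p - 2) * (‖a‖ * ‖a + b‖ - inner ℝ a (a + b)) =
      ‖a + b‖ ^ p - ‖a‖ ^ p - p * (‖a‖ ^ (p - 2) * inner ℝ a b) := by
    rcases eq_or_ne a 0 with rfl | ha
    · simp [Real.zero_rpow (show p - 1 ≠ 0 by linarith)]
    · have : ‖a‖ ^ (p - 1) = ‖a‖ ^ (p - 2) * ‖a‖ := by
        rw [← Real.rpow_add_one (norm_ne_zero_iff.2 ha)]; congr 1; ring
      rw [this, e0]; ring
  rw [e1, e2] at h1 h2
  have e3 : ‖b‖ ^ (2 : ℝ) = ‖b‖ ^ 2 := by norm_num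
  rw [e3]
  have t1 : ‖a + b‖ ≤ ‖a‖ + ‖b‖ := norm_add_le a b
  have t2 : ‖b‖ ≤ ‖a + b‖ + ‖a‖ := by
    have := norm_sub_le (a + b) a
    rwa [add_sub_cancel_left] at this
  have m1 := le_max_left ‖a + b‖ ‖a‖
  have m2 := le_max_right ‖a + b‖ ‖a‖
  have hM : max ‖a + b‖ ‖a‖ ≤ ‖a‖ + ‖b‖ := max_le t1 (by linarith)
  have q1 := rpow_le_three_rpow_mul (q := p - 2) (x := ‖a‖ + ‖b‖) (y := max ‖a + b‖ ‖a‖)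
    (by positivity) (by linarith) (by linarith) (by linarith)
  have q2 := rpow_le_three_rpow_mul (q := p - 2) (y := ‖a‖ + ‖b‖) (x := max ‖a + b‖ ‖a‖)
    (by linarith) (by positivity) (by linarith) (by linarith)
  constructor
  · calc _ ≤ ‖b‖ ^ 2 * (3 ^ |p - 2| * max ‖a + b‖ ‖a‖ ^ (p - 2)) := by gcongr
      _ = 3 ^ |p - 2| * (‖b‖ ^ 2 * max ‖a + b‖ ‖a‖ ^ (p - 2)) := by ring
      _ ≤ 3 ^ |p - 2| * (K * _) := by gcongr
      _ = _ := by ring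
  · calc _ ≤ K * (‖b‖ ^ 2 * max ‖a + b‖ ‖a‖ ^ (p - 2)) := h2
      _ ≤ K * (‖b‖ ^ 2 * (3 ^ |p - 2| * (‖a‖ + ‖b‖) ^ (p - 2))) := by gcongr
      _ = _ := by ring

theorem rpow_add_rpow_comparable {q : ℝ} (hq : 0 ≤ q) {x y : ℝ} (hx : 0 ≤ x) (hy : 0 ≤ y) :
    (x + y) ^ q ≤ 2 ^ (q + 1) * (x ^ q + y ^ q) ∧
      x ^ q + y ^ q ≤ 2 ^ (q + 1) * (x + y) ^ q := by
  have h2 : (2 : ℝ) ^ (q + 1) = 2 ^ q * 2 := Real.rpow_add_one (by norm_num) q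
  have h3 : (1 : ℝ) ≤ 2 ^ q := Real.one_le_rpow (by norm_num) hq
  have hx' : 0 ≤ x ^ q := by positivity
  have hy' : 0 ≤ y ^ q := by positivity
  rw [h2]
  constructor
  · have h1 : (x + y) ^ q ≤ (2 * max x y) ^ q :=
      Real.rpow_le_rpow (by positivity) (by linarith [le_max_left x y, le_max_right x y]) hq
    rw [Real.mul_rpow (by norm_num) (hx.trans (le_max_left x y))] at h1
    have h4 : max x y ^ q ≤ x ^ q + y ^ q := by
      rcases max_choice x y with h | h <;> rw [h] <;> linarith
    nlinarith
  · have h1 : x ^ q ≤ (x + y) ^ q := Real.rpow_le_rpow hx (by linarith) hq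
    have h4 : y ^ q ≤ (x + y) ^ q := Real.rpow_le_rpow hy (by linarith) hq
    nlinarith

theorem norm_gradient_sub {d : ℕ} {f g : Ed d → ℝ} (x : Ed d) :
    ‖gradient f x - gradient g x‖ = ‖fderiv ℝ f x - fderiv ℝ g x‖ := by
  rw [gradient, gradient, ← map_sub, LinearIsometryEquiv.norm_map]

/-- Mollification: a compactly supported `C¹` function is approximated in `C¹` by test functions
supported in a fixed compact subset. -/
theorem exists_compact_forall_isTestFun_approx {d : ℕ} {Ω : Set (Ed d)} (hΩ : IsOpen Ω)
    {φ : Ed d → ℝ} (hφ : ContDiff ℝ 1 φ) (hc : HasCompactSupport φ) (hs : tsupport φ ⊆ Ω) :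
    ∃ K : Set (Ed d), IsCompact K ∧ K ⊆ Ω ∧ tsupport φ ⊆ K ∧ ∀ ε > 0, ∃ ψ : Ed d → ℝ,
      IsTestFun Ω ψ ∧ tsupport ψ ⊆ K ∧ (∀ x, ‖ψ x - φ x‖ ≤ ε) ∧
        ∀ x, ‖gradient ψ x - gradient φ x‖ ≤ ε := by
  obtain ⟨δ₀, hδ₀, hK⟩ := hc.isCompact.exists_cthickening_subset_open hΩ hs
  have hKc : IsCompact (cthickening δ₀ (tsupport φ)) := hc.isCompact.cthickening
  refine ⟨_, hKc, hK, self_subset_cthickening _, fun ε hε => ?_⟩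
  have hdc : Continuous (fderiv ℝ φ) := hφ.continuous_fderiv one_ne_zero
  obtain ⟨δ₁, hδ₁, h₁⟩ := Metric.uniformContinuous_iff.1
    (hc.uniformContinuous_of_continuous hφ.continuous) ε hε
  obtain ⟨δ₂, hδ₂, h₂⟩ := Metric.uniformContinuous_iff.1
    ((hc.fderiv ℝ).uniformContinuous_of_continuous hdc) ε hε
  set δ := min δ₀ (min δ₁ δ₂) with hδdef
  have hδ : 0 < δ := lt_min hδ₀ (lt_min hδ₁ hδ₂)
  let ρ : ContDiffBump (0 : Ed d) := ⟨δ / 2, δ, half_pos hδ, half_lt_self hδ⟩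
  set ψ : Ed d → ℝ := convolution (ρ.normed volume) φ (ContinuousLinearMap.lsmul ℝ ℝ) volume
    with hψ
  have hli : LocallyIntegrable (ρ.normed (volume : Measure (Ed d))) volume :=
    ρ.continuous_normed.locallyIntegrable
  have hsupp : tsupport ψ ⊆ cthickening δ₀ (tsupport φ) := by
    refine closure_minimal ?_ isClosed_cthickening
    intro x hx
    obtain ⟨y, hy, z, hz, rfl⟩ := support_convolution_subset _ hx
    rw [ρ.support_normed_eq] at hy
    refine mem_cthickening_of_dist_le _ z _ _ (subset_tsupport _ hz) ?_
    have : ‖y‖ < δ := by simpa using hy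
    have e : dist (y + z) z = ‖y‖ := by simp [dist_eq_norm]
    rw [e]
    exact this.le.trans (min_le_left _ _)
  refine ⟨ψ, ⟨?_, hKc.of_isClosed_subset (isClosed_tsupport _) hsupp, hsupp.trans hK⟩, hsupp,
    fun x => ?_, fun x => ?_⟩
  · exact ρ.hasCompactSupport_normed.contDiff_convolution_left _ ρ.contDiff_normed
      hφ.continuous.locallyIntegrable
  · rw [← dist_eq_norm]
    refine ρ.dist_normed_convolution_le hφ.continuous.aestronglyMeasurable fun y hy => ?_
    refine (h₁ (lt_of_lt_of_le (mem_ball.1 hy) ?_)).le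
    exact (min_le_right _ _).trans (min_le_left _ _)
  · have hder : fderiv ℝ ψ x =
        convolution (ρ.normed volume) (fderiv ℝ φ) (ContinuousLinearMap.lsmul ℝ ℝ) volume x :=
      (hc.hasFDerivAt_convolution_right (ContinuousLinearMap.lsmul ℝ ℝ) hli hφ x).fderiv
    rw [norm_gradient_sub, hder, ← dist_eq_norm]
    refine ρ.dist_normed_convolution_le hdc.aestronglyMeasurable fun y hy => ?_
    refine (h₂ (lt_of_lt_of_le (mem_ball.1 hy) ?_)).le
    exact (min_le_right _ _).trans (min_le_right _ _)

theorem gradient_eq_zero_of_notMem_tsupport {d : ℕ} {f : Ed d → ℝ} {x : Ed d}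
    (hx : x ∉ tsupport f) : gradient f x = 0 := by
  rw [gradient, fderiv_of_notMem_tsupport ℝ hx, map_zero]

theorem continuousOn_gradient {d : ℕ} {Ω : Set (Ed d)} (hΩ : IsOpen Ω) {v : Ed d → ℝ}
    (hv : ContDiffOn ℝ 1 v Ω) : ContinuousOn (gradient v) Ω :=
  (LinearIsometryEquiv.continuous _).comp_continuousOn
    (hv.continuousOn_fderiv_of_isOpen hΩ le_rfl)

theorem integrableOn_of_bounded_of_eq_zero_off {d : ℕ} {Ω K : Set (Ed d)} (hΩ : IsOpen Ω)
    (hK : IsCompact K) (hKΩ : K ⊆ Ω) {g : Ed d → ℝ} {B : ℝ}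
    (hg : AEStronglyMeasurable g (volume.restrict Ω)) (hB : ∀ x ∈ K, ‖g x‖ ≤ B)
    (h0 : ∀ x ∈ Ω, x ∉ K → g x = 0) : IntegrableOn g Ω := by
  have h1 : IntegrableOn g K := by
    refine IntegrableOn.of_bound hK.measure_lt_top
      (hg.mono_measure (Measure.restrict_mono hKΩ le_rfl)) B ?_
    exact (ae_restrict_iff' hK.measurableSet).2 (Eventually.of_forall hB)
  exact h1.of_forall_sdiff_eq_zero hΩ.measurableSet fun x hx => h0 x hx.1 hx.2

/-- The weak formulation extends from smooth to `C¹` compactly supported test functions, and its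
integrand is integrable. -/
theorem IsSolution.integral_eq_zero {d : ℕ} {p : ℝ} (hp : 1 < p) {Ω : Set (Ed d)}
    (hΩ : IsOpen Ω) {V v φ : Ed d → ℝ} (hV : LinfLoc Ω V) (hv : ContDiffOn ℝ 1 v Ω)
    (hsol : IsSolution p V Ω v) (hφ : ContDiff ℝ 1 φ) (hc : HasCompactSupport φ)
    (hs : tsupport φ ⊆ Ω) :
    IntegrableOn (fun x => ‖gradient v x‖ ^ (p - 2) * inner ℝ (gradient v x) (gradient φ x)
      + V x * |v x| ^ (p - 2) * v x * φ x) Ω ∧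
    ∫ x in Ω, (‖gradient v x‖ ^ (p - 2) * inner ℝ (gradient v x) (gradient φ x)
      + V x * |v x| ^ (p - 2) * v x * φ x) = 0 := by
  obtain ⟨K, hK, hKΩ, hφK, happ⟩ := exists_compact_forall_isTestFun_approx hΩ hφ hc hs
  have hgv := continuousOn_gradient hΩ hv
  have rpow_mul_self : ∀ {t : ℝ}, 0 ≤ t → t ^ (p - 2) * t = t ^ (p - 1) := fun {t} ht => by
    rcases ht.eq_or_lt with rfl | ht
    · rw [mul_zero, Real.zero_rpow (by linarith)]
    · rw [← Real.rpow_add_one ht.ne']; congr 1; ring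
  obtain ⟨CV, hCV⟩ := hV.2 K hK hKΩ
  obtain ⟨C1, hC1⟩ := hK.exists_bound_of_continuousOn (f := fun x => ‖gradient v x‖ ^ (p - 1))
    ((hgv.mono hKΩ).norm.rpow_const fun x _ => Or.inr (by linarith))
  obtain ⟨C2, hC2⟩ := hK.exists_bound_of_continuousOn (f := fun x => |v x| ^ (p - 1))
    ((hv.continuousOn.mono hKΩ).abs.rpow_const fun x _ => Or.inr (by linarith))
  -- the integrand as a function of the value and gradient of the test function
  let F : Ed d → ℝ → Ed d → ℝ := fun x y z =>
    ‖gradient v x‖ ^ (p - 2) * inner ℝ (gradient v x) z + V x * |v x| ^ (p - 2) * v x * y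
  have hFsub : ∀ x y z y' z', F x y z - F x y' z' = F x (y - y') (z - z') := by
    intro x y z y' z'
    simp only [F, inner_sub_right]
    ring
  have hFbound : ∀ x ∈ K, ∀ y z B, ‖y‖ ≤ B → ‖z‖ ≤ B → ‖F x y z‖ ≤ (C1 + CV * C2) * B := by
    intro x hx y z B hy hz
    have hB : 0 ≤ B := (norm_nonneg _).trans hy
    have k1 : ‖‖gradient v x‖ ^ (p - 2) * inner ℝ (gradient v x) z‖ ≤ C1 * B := by
      rw [norm_mul, Real.norm_of_nonneg (by positivity)]
      calc _ ≤ ‖gradient v x‖ ^ (p - 2) * (‖gradient v x‖ * ‖z‖) := by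
            gcongr; exact norm_inner_le_norm _ _
        _ = ‖gradient v x‖ ^ (p - 1) * ‖z‖ := by rw [← mul_assoc, rpow_mul_self (norm_nonneg _)]
        _ ≤ C1 * B := by
            have := (le_abs_self _).trans (hC1 x hx)
            have h0 : 0 ≤ ‖gradient v x‖ ^ (p - 1) := by positivity
            exact mul_le_mul this hz (norm_nonneg _) (h0.trans this)
    have k2 : ‖V x * |v x| ^ (p - 2) * v x * y‖ ≤ CV * C2 * B := by
      rw [norm_mul, norm_mul, norm_mul, Real.norm_of_nonneg (show 0 ≤ |v x| ^ (p - 2) by positivity),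
        mul_assoc ‖V x‖, Real.norm_eq_abs (v x), rpow_mul_self (abs_nonneg _)]
      have h2 := (le_abs_self _).trans (hC2 x hx)
      have h0 : 0 ≤ |v x| ^ (p - 1) := by positivity
      have hV0 := (abs_nonneg _).trans (hCV x hx)
      exact mul_le_mul (mul_le_mul (hCV x hx) h2 h0 hV0) hy (norm_nonneg _)
        (mul_nonneg hV0 (h0.trans h2))
    calc _ ≤ _ := norm_add_le _ _
      _ ≤ _ := by linarith
  have key : ∀ χ : Ed d → ℝ, ContDiff ℝ 1 χ → HasCompactSupport χ → tsupport χ ⊆ K →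
      IntegrableOn (fun x => F x (χ x) (gradient χ x)) Ω := by
    intro χ hχ hχc hχK
    have hgχ : Continuous (gradient χ) :=
      (LinearIsometryEquiv.continuous _).comp (hχ.continuous_fderiv one_ne_zero)
    obtain ⟨B1, hB1⟩ := hK.exists_bound_of_continuousOn hgχ.continuousOn
    obtain ⟨B2, hB2⟩ := hK.exists_bound_of_continuousOn hχ.continuous.continuousOn
    refine integrableOn_of_bounded_of_eq_zero_off hΩ hK hKΩ (B := (C1 + CV * C2) * max B1 B2)
      ?_ (fun x hx => hFbound x hx _ _ _ ((hB2 x hx).trans (le_max_right _ _))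
        ((hB1 x hx).trans (le_max_left _ _))) ?_
    · have m1 : AEMeasurable (gradient v) (volume.restrict Ω) := hgv.aemeasurable hΩ.measurableSet
      have m2 : AEMeasurable v (volume.restrict Ω) :=
        hv.continuousOn.aemeasurable hΩ.measurableSet
      have m3 : AEMeasurable V (volume.restrict Ω) := hV.1.aemeasurable
      have m5 : AEMeasurable χ (volume.restrict Ω) := hχ.continuous.aemeasurable
      have m6 : AEMeasurable (gradient χ) (volume.restrict Ω) := hgχ.aemeasurable
      have m4 : AEMeasurable (fun x => |v x|) (volume.restrict Ω) := m2.norm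
      exact (((m1.norm.pow_const _).mul (m1.inner m6)).add
        (((m3.mul (m4.pow_const _)).mul m2).mul m5)).aestronglyMeasurable
    · intro x _ hx
      have hx' := fun h => hx (hχK h)
      simp [F, gradient_eq_zero_of_notMem_tsupport hx', image_eq_zero_of_notMem_tsupport hx']
  have hint := key φ hφ hc hφK
  refine ⟨hint, ?_⟩
  change ∫ x in Ω, F x (φ x) (gradient φ x) = 0
  refine norm_le_zero_iff.1 (le_of_forall_pos_le_add fun η hη => ?_)
  set M := (C1 + CV * C2) * volume.real K with hM
  obtain ⟨ψ, hψ, hψK, hψ1, hψ2⟩ := happ (η / (|M| + 1)) (by positivity)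
  have hψ0 : ∫ x in Ω, F x (ψ x) (gradient ψ x) = 0 := hsol ψ hψ
  have hψint := key ψ (hψ.1.of_le (by exact_mod_cast le_top)) hψ.2.1 hψK
  have e : ∫ x in Ω, F x (φ x) (gradient φ x) =
      ∫ x in K, F x (φ x - ψ x) (gradient φ x - gradient ψ x) := by
    rw [← sub_zero (∫ x in Ω, F x (φ x) (gradient φ x)), ← hψ0, ← integral_sub hint hψint]
    simp only [hFsub]
    refine setIntegral_eq_of_subset_of_forall_sdiff_eq_zero hΩ.measurableSet hKΩ fun x hx => ?_
    have h1 := fun h => hx.2 (hφK h)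
    have h2 := fun h => hx.2 (hψK h)
    simp [F, gradient_eq_zero_of_notMem_tsupport h1, image_eq_zero_of_notMem_tsupport h1,
      gradient_eq_zero_of_notMem_tsupport h2, image_eq_zero_of_notMem_tsupport h2]
  rw [e]
  refine (norm_setIntegral_le_of_norm_le_const hK.measure_lt_top
    (C := (C1 + CV * C2) * (η / (|M| + 1))) fun x hx => ?_).trans ?_
  · exact hFbound x hx _ _ _ (by rw [norm_sub_rev]; exact hψ1 x)
      (by rw [norm_sub_rev]; exact hψ2 x)
  · have : (C1 + CV * C2) * (η / (|M| + 1)) * volume.real K = M * (η / (|M| + 1)) := by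
      rw [hM]; ring
    rw [this, zero_add]
    calc M * (η / (|M| + 1)) ≤ (|M| + 1) * (η / (|M| + 1)) := by
          gcongr; linarith [le_abs_self M]
      _ = η := by field_simp

theorem gradient_mul' {d : ℕ} {f g : Ed d → ℝ} {x : Ed d} (hf : DifferentiableAt ℝ f x)
    (hg : DifferentiableAt ℝ g x) :
    gradient (fun y => f y * g y) x = f x • gradient g x + g x • gradient f x := by
  simp only [gradient, fderiv_fun_mul hf hg, map_add, map_smulₛₗ, conj_trivial]

theorem gradient_rpow_const {d : ℕ} {f : Ed d → ℝ} {x : Ed d} {p : ℝ} (hp : 1 ≤ p)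
    (hf : DifferentiableAt ℝ f x) :
    gradient (fun y => f y ^ p) x = (p * f x ^ (p - 1)) • gradient f x := by
  simp only [gradient, (hf.hasFDerivAt.rpow_const (Or.inr hp)).fderiv, map_smulₛₗ, conj_trivial]

/-- The Bregman divergence of `‖·‖ ^ p` at the two parts `w ∇v` and `v ∇w` of `∇(v w)`. -/
def gradientBregman {d : ℕ} (p : ℝ) (v w : Ed d → ℝ) (x : Ed d) : ℝ :=
  ‖w x • gradient v x + v x • gradient w x‖ ^ p - ‖w x • gradient v x‖ ^ p -
    p * (‖w x • gradient v x‖ ^ (p - 2) *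
      inner ℝ (w x • gradient v x) (v x • gradient w x))

/-- Picone-type identity: the energy of `v w` is the integral of a Bregman divergence when `v` is a
positive solution. -/
theorem IsSolution.Qf_mul_eq {d : ℕ} {p : ℝ} (hp : 1 < p) {Ω : Set (Ed d)} (hΩ : IsOpen Ω)
    {V v w : Ed d → ℝ} (hV : LinfLoc Ω V) (hv : ContDiffOn ℝ 1 v Ω) (hpos : ∀ x ∈ Ω, 0 < v x)
    (hsol : IsSolution p V Ω v) (hw : ContDiff ℝ 1 w) (hc : HasCompactSupport w)
    (hs : tsupport w ⊆ Ω) (hw0 : ∀ x, 0 ≤ w x) :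
    IntegrableOn (gradientBregman p v w) Ω ∧
      Qf p V Ω (fun x => v x * w x) = (1 / p) * ∫ x in Ω, gradientBregman p v w x := by
  have hp0 : p ≠ 0 := by linarith
  have hgv := continuousOn_gradient hΩ hv
  have hgw : Continuous (gradient w) :=
    (LinearIsometryEquiv.continuous _).comp (hw.continuous_fderiv one_ne_zero)
  have hvd : ∀ x ∈ Ω, DifferentiableAt ℝ v x := fun x hx =>
    (hv.contDiffAt (hΩ.mem_nhds hx)).differentiableAt one_ne_zero
  have hwd : Differentiable ℝ w := hw.differentiable one_ne_zero
  have hwp : ContDiff ℝ 1 (fun x => w x ^ p) :=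
    hw.rpow_const_of_le (by exact_mod_cast hp.le)
  set φ : Ed d → ℝ := fun x => v x * w x ^ p with hφdef
  have hφsupp : tsupport φ ⊆ tsupport w := by
    refine closure_mono fun x hx hx0 => hx ?_
    simp [hφdef, hx0, Real.zero_rpow hp0]
  have hφ : ContDiff ℝ 1 φ := by
    refine contDiff_iff_contDiffAt.2 fun x => ?_
    by_cases hx : x ∈ Ω
    · exact (hv.contDiffAt (hΩ.mem_nhds hx)).mul hwp.contDiffAt
    · have hx' : x ∉ tsupport φ := fun h => hx (hs (hφsupp h))
      exact contDiffAt_const.congr_of_eventuallyEq (notMem_tsupport_iff_eventuallyEq.1 hx')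
  have hφc : HasCompactSupport φ := hc.of_isClosed_subset (isClosed_tsupport _) hφsupp
  obtain ⟨hint0, hzero⟩ :=
    hsol.integral_eq_zero hp hΩ hV hv hφ hφc (hφsupp.trans hs)
  have hgrad : ∀ x ∈ Ω, gradient (fun y => v y * w y) x =
      w x • gradient v x + v x • gradient w x := fun x hx => by
    rw [gradient_mul' (hvd x hx) (hwd x), add_comm]
  have hintQ : IntegrableOn
      (fun x => ‖gradient (fun y => v y * w y) x‖ ^ p + V x * |v x * w x| ^ p) Ω := by
    have hcont : ContinuousOn (fun x => ‖w x • gradient v x + v x • gradient w x‖ ^ p) Ω :=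
      ((hw.continuous.continuousOn.smul hgv).add
        (hv.continuousOn.smul hgw.continuousOn)).norm.rpow_const fun x _ => Or.inr (by linarith)
    have hcont' : ContinuousOn (fun x => |v x * w x| ^ p) Ω :=
      (hv.continuousOn.mul hw.continuous.continuousOn).abs.rpow_const
        fun x _ => Or.inr (by linarith)
    have hcongr : EqOn (fun x => ‖w x • gradient v x + v x • gradient w x‖ ^ p +
          V x * |v x * w x| ^ p)
        (fun x => ‖gradient (fun y => v y * w y) x‖ ^ p + V x * |v x * w x| ^ p) Ω :=
      fun x hx => by simp only [hgrad x hx]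
    refine IntegrableOn.congr_fun ?_ hcongr hΩ.measurableSet
    obtain ⟨CV, hCV⟩ := hV.2 _ hc.isCompact hs
    obtain ⟨B1, hB1⟩ := hc.isCompact.exists_bound_of_continuousOn (hcont.mono hs)
    obtain ⟨B2, hB2⟩ := hc.isCompact.exists_bound_of_continuousOn (hcont'.mono hs)
    refine integrableOn_of_bounded_of_eq_zero_off hΩ hc.isCompact hs (B := B1 + CV * B2) ?_
      (fun x hx => ?_) fun x _ hx => ?_
    · exact ((hcont.aemeasurable hΩ.measurableSet).add
        (hV.1.aemeasurable.mul (hcont'.aemeasurable hΩ.measurableSet))).aestronglyMeasurable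
    · refine (norm_add_le _ _).trans (add_le_add (hB1 x hx) ?_)
      rw [norm_mul]
      exact mul_le_mul (hCV x hx) (hB2 x hx) (norm_nonneg _) ((abs_nonneg _).trans (hCV x hx))
    · simp [gradient_eq_zero_of_notMem_tsupport hx, image_eq_zero_of_notMem_tsupport hx,
        Real.zero_rpow hp0]
  have hpoint : EqOn (fun x => (‖gradient (fun y => v y * w y) x‖ ^ p + V x * |v x * w x| ^ p) -
      (‖gradient v x‖ ^ (p - 2) * inner ℝ (gradient v x) (gradient φ x)
        + V x * |v x| ^ (p - 2) * v x * φ x)) (gradientBregman p v w) Ω := by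
    intro x hx
    have hvx := hpos x hx
    have hwx := hw0 x
    have g1 : gradient φ x = v x • ((p * w x ^ (p - 1)) • gradient w x) +
        w x ^ p • gradient v x := by
      rw [hφdef, gradient_mul' (hvd x hx) ((hwp.differentiable one_ne_zero) x),
        gradient_rpow_const hp.le (hwd x)]
    have g2 : (v x) ^ p = v x ^ (p - 2) * v x * v x := by
      rw [← Real.rpow_add_one hvx.ne', ← Real.rpow_add_one hvx.ne']; congr 1; ring
    have g3 : ‖gradient v x‖ ^ (p - 2) * ‖gradient v x‖ ^ 2 = ‖gradient v x‖ ^ p := by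
      rcases (norm_nonneg (gradient v x)).eq_or_lt with h | h
      · rw [← h, Real.zero_rpow hp0]; simp
      · rw [← Real.rpow_natCast, ← Real.rpow_add h]; norm_num
    have g4 : w x ^ (p - 2) * w x = w x ^ (p - 1) := by
      rcases hwx.eq_or_lt with h | h
      · rw [← h, Real.zero_rpow (show p - 1 ≠ 0 by linarith)]; simp
      · rw [← Real.rpow_add_one h.ne']; congr 1; ring
    simp only [gradientBregman, hgrad x hx, g1, inner_add_right, real_inner_smul_right,
      real_inner_smul_left, real_inner_self_eq_norm_sq]
    rw [norm_smul (w x), Real.norm_of_nonneg hwx, Real.mul_rpow hwx (norm_nonneg _),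
      Real.mul_rpow hwx (norm_nonneg _), abs_of_pos hvx, abs_of_nonneg (mul_nonneg hvx.le hwx),
      Real.mul_rpow hvx.le hwx, ← g3, ← g4, g2]
    simp only [hφdef]
    ring
  have hsub := hintQ.sub hint0
  refine ⟨hsub.congr_fun hpoint hΩ.measurableSet, ?_⟩
  rw [Qf, ← setIntegral_congr_fun hΩ.measurableSet hpoint, integral_sub hintQ hint0, hzero,
    sub_zero]

theorem integral_comparable {α : Type*} [MeasurableSpace α] {μ : Measure α} {s : Set α}
    (hs : MeasurableSet s) {D g : α → ℝ} {K p : ℝ} (hK : 1 ≤ K) (hp : 1 ≤ p)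
    (hD : IntegrableOn D s μ) (hg : AEStronglyMeasurable g (μ.restrict s))
    (hg0 : ∀ x ∈ s, 0 ≤ g x) (hgD : ∀ x ∈ s, g x ≤ K * D x) (hDg : ∀ x ∈ s, D x ≤ K * g x) :
    (K * p)⁻¹ * ∫ x in s, g x ∂μ ≤ (1 / p) * ∫ x in s, D x ∂μ ∧
      (1 / p) * ∫ x in s, D x ∂μ ≤ (K * p) * ∫ x in s, g x ∂μ := by
  have hgi : IntegrableOn g s μ := by
    refine (hD.const_mul K).mono' hg ((ae_restrict_iff' hs).2 (Eventually.of_forall fun x hx => ?_))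
    rw [Real.norm_of_nonneg (hg0 x hx)]
    exact hgD x hx
  have h1 : ∫ x in s, g x ∂μ ≤ K * ∫ x in s, D x ∂μ := by
    rw [← integral_const_mul]
    exact setIntegral_mono_on hgi (hD.const_mul K) hs hgD
  have h2 : ∫ x in s, D x ∂μ ≤ K * ∫ x in s, g x ∂μ := by
    rw [← integral_const_mul]
    exact setIntegral_mono_on hD (hgi.const_mul K) hs hDg
  have h0 : 0 ≤ ∫ x in s, g x ∂μ := setIntegral_nonneg hs hg0
  have hK0 : 0 < K := by linarith
  have hp0 : 0 < p := by linarith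
  constructor
  · rw [mul_inv, one_div, mul_comm K⁻¹, mul_assoc]
    gcongr
    rwa [inv_mul_le_iff₀ hK0]
  · rw [one_div, inv_mul_le_iff₀ hp0]
    have : 0 ≤ K * ∫ x in s, g x ∂μ := by positivity
    have hpp : 1 ≤ p * p := by nlinarith
    nlinarith

theorem statement_3 (p : ℝ) (hp : 1 < p) :
    ∃ C : ℝ, 0 < C ∧
      ∀ (d : ℕ), 2 ≤ d →
      ∀ Ω : Set (Ed d), IsOpen Ω → IsConnected Ω →
      ∀ V : Ed d → ℝ, LinfLoc Ω V →
      ∀ v : Ed d → ℝ, ContDiffOn ℝ 1 v Ω → (∀ x ∈ Ω, 0 < v x) → IsSolution p V Ω v →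
      ∀ w : Ed d → ℝ, ContDiff ℝ 1 w → HasCompactSupport w → tsupport w ⊆ Ω →
        (∀ x, 0 ≤ w x) →
        (C⁻¹ * (∫ x in Ω, (v x) ^ (2 : ℝ) * ‖gradient w x‖ ^ (2 : ℝ) *
              (w x * ‖gradient v x‖ + v x * ‖gradient w x‖) ^ (p - 2)) ≤
            Qf p V Ω (fun x => v x * w x) ∧
          Qf p V Ω (fun x => v x * w x) ≤
            C * ∫ x in Ω, (v x) ^ (2 : ℝ) * ‖gradient w x‖ ^ (2 : ℝ) *
              (w x * ‖gradient v x‖ + v x * ‖gradient w x‖) ^ (p - 2)) ∧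
        (2 ≤ p →
          C⁻¹ * (∫ x in Ω, ((v x) ^ p * ‖gradient w x‖ ^ p +
                (v x) ^ (2 : ℝ) * ‖gradient v x‖ ^ (p - 2) * (w x) ^ (p - 2) *
                  ‖gradient w x‖ ^ (2 : ℝ))) ≤
              Qf p V Ω (fun x => v x * w x) ∧
            Qf p V Ω (fun x => v x * w x) ≤
              C * ∫ x in Ω, ((v x) ^ p * ‖gradient w x‖ ^ p +
                (v x) ^ (2 : ℝ) * ‖gradient v x‖ ^ (p - 2) * (w x) ^ (p - 2) *
                  ‖gradient w x‖ ^ (2 : ℝ))) := by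
  obtain ⟨K, hK, H⟩ := bregman_norm_rpow hp
  set L : ℝ := 2 ^ (p - 2 + 1)
  have hL : 1 ≤ L := Real.one_le_rpow (by norm_num) (by linarith)
  have hKL : 1 ≤ K * L := by nlinarith
  have hK0 : 0 < K := by linarith
  have hL0 : 0 < L := by linarith
  refine ⟨K * L * p, by positivity, ?_⟩
  intro d _ Ω hΩ _ V hV v hv hpos hsol w hw hc hs hw0
  obtain ⟨hDint, hQ⟩ := hsol.Qf_mul_eq hp hΩ hV hv hpos hw hc hs hw0
  rw [hQ]
  have mv : AEMeasurable v (volume.restrict Ω) := hv.continuousOn.aemeasurable hΩ.measurableSet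
  have mgv : AEMeasurable (fun x => ‖gradient v x‖) (volume.restrict Ω) :=
    ((continuousOn_gradient hΩ hv).aemeasurable hΩ.measurableSet).norm
  have mw : AEMeasurable w (volume.restrict Ω) := hw.continuous.aemeasurable
  have mgw : AEMeasurable (fun x => ‖gradient w x‖) (volume.restrict Ω) :=
    ((continuousOn_gradient hΩ hw.contDiffOn).aemeasurable hΩ.measurableSet).norm
  have hT : ∀ x ∈ Ω, (v x) ^ (2 : ℝ) * ‖gradient w x‖ ^ (2 : ℝ) *
      (w x * ‖gradient v x‖ + v x * ‖gradient w x‖) ^ (p - 2) =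
      ‖v x • gradient w x‖ ^ (2 : ℝ) *
        (‖w x • gradient v x‖ + ‖v x • gradient w x‖) ^ (p - 2) := by
    intro x hx
    rw [norm_smul, norm_smul, Real.norm_of_nonneg (hpos x hx).le, Real.norm_of_nonneg (hw0 x),
      Real.mul_rpow (hpos x hx).le (norm_nonneg _)]
  have hH : ∀ x, _ := fun x => H d (w x • gradient v x) (v x • gradient w x)
  refine ⟨integral_comparable hΩ.measurableSet hKL hp.le hDint ?_ (fun x hx => ?_)
    (fun x hx => ?_) (fun x hx => ?_), fun hp2 => integral_comparable hΩ.measurableSet hKL hp.le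
      hDint ?_ (fun x hx => ?_) (fun x hx => ?_) (fun x hx => ?_)⟩
  · exact (((mv.pow_const _).mul (mgw.pow_const _)).mul
      (((mw.mul mgv).add (mv.mul mgw)).pow_const _)).aestronglyMeasurable
  · rw [hT x hx]; positivity
  · rw [hT x hx]
    have h0 : 0 ≤ K * gradientBregman p v w x := le_trans (by positivity) (hH x).1
    calc _ ≤ K * gradientBregman p v w x := (hH x).1
      _ ≤ L * (K * gradientBregman p v w x) := le_mul_of_one_le_left h0 hL
      _ = _ := by ring
  · rw [hT x hx]
    calc _ ≤ _ := (hH x).2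
      _ ≤ L * _ := le_mul_of_one_le_left (by positivity) hL
      _ = _ := by ring
  · exact (((mv.pow_const _).mul (mgw.pow_const _)).add
      ((((mv.pow_const _).mul (mgv.pow_const _)).mul (mw.pow_const _)).mul
        (mgw.pow_const _))).aestronglyMeasurable
  all_goals
    have hvx := (hpos x hx).le
    have hwx := hw0 x
    have hS : (v x) ^ p * ‖gradient w x‖ ^ p + (v x) ^ (2 : ℝ) * ‖gradient v x‖ ^ (p - 2) *
        (w x) ^ (p - 2) * ‖gradient w x‖ ^ (2 : ℝ) = ‖v x • gradient w x‖ ^ (2 : ℝ) *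
          (‖w x • gradient v x‖ ^ (p - 2) + ‖v x • gradient w x‖ ^ (p - 2)) := by
      rw [mul_add, ← Real.rpow_add_of_nonneg (norm_nonneg _) (by norm_num) (by linarith),
        show 2 + (p - 2) = p by ring, norm_smul, norm_smul, Real.norm_of_nonneg hvx,
        Real.norm_of_nonneg hwx, Real.mul_rpow hvx (norm_nonneg _),
        Real.mul_rpow hvx (norm_nonneg _), Real.mul_rpow hwx (norm_nonneg _)]
      ring
    obtain ⟨c1, c2⟩ := rpow_add_rpow_comparable (q := p - 2) (by linarith)
      (norm_nonneg (w x • gradient v x)) (norm_nonneg (v x • gradient w x))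
    rw [hS]
  · positivity
  · calc _ ≤ ‖v x • gradient w x‖ ^ (2 : ℝ) *
          (L * (‖w x • gradient v x‖ + ‖v x • gradient w x‖) ^ (p - 2)) := by gcongr
      _ = L * (‖v x • gradient w x‖ ^ (2 : ℝ) *
          (‖w x • gradient v x‖ + ‖v x • gradient w x‖) ^ (p - 2)) := by ring
      _ ≤ L * (K * gradientBregman p v w x) := mul_le_mul_of_nonneg_left (hH x).1 hL0.le
      _ = _ := by ring
  · calc _ ≤ K * (‖v x • gradient w x‖ ^ (2 : ℝ) *
          (‖w x • gradient v x‖ + ‖v x • gradient w x‖) ^ (p - 2)) := (hH x).2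
      _ ≤ K * (‖v x • gradient w x‖ ^ (2 : ℝ) * (L * (‖w x • gradient v x‖ ^ (p - 2) +
          ‖v x • gradient w x‖ ^ (p - 2)))) := by gcongr
      _ = _ := by ring
end
end

section
/- Let v ∈ C¹(Ω) be a nonnegative subsolution of Q'(u) = 0 in Ω and let w ∈ C¹(Ω) be nonnegative with compact support in Ω. Then there exists a constant C > 0 depending only on p such that Q(vw) ≤ C ∫_{Ω∩{v>0}} v²|∇w|²(w|∇v| + v|∇w|)^{p−2} dx. In particular, if p ≥ 2, then Q(vw) ≤ C ∫_Ω (v^p|∇w|^p + v²|∇v|^{p−2}w^{p−2}|∇w|²) dx. -/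
open MeasureTheory Filter Set Metric
open scoped RealInnerProductSpace Topology NNReal

noncomputable section

/-- Second-order upper Taylor bound for `y ↦ y ^ q` at `1`. -/
theorem exists_rpow_le_one_add_mul_add_sq (q : ℝ) (hq : 0 < q) (R : ℝ) :
    ∃ M : ℝ, 0 ≤ M ∧ ∀ y : ℝ, 0 < y → y ≤ R → y ^ q ≤ 1 + q * (y - 1) + M * (y - 1) ^ 2 := by
  rcases le_total q 1 with h1 | h1
  · refine ⟨0, le_rfl, fun y hy _ => ?_⟩
    have := rpow_one_add_le_one_add_mul_self (s := y - 1) (by linarith) hq.le h1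
    simpa using this
  · obtain ⟨n, hn⟩ := exists_nat_ge (q - 1)
    refine ⟨q * ∑ i ∈ Finset.range n, |R| ^ i, by positivity, fun y hy hyR => ?_⟩
    have tangent : y ^ q - 1 ≤ q * y ^ (q - 1) * (y - 1) := by
      have hb := one_add_mul_self_le_rpow_one_add (s := y⁻¹ - 1)
        (by have := inv_pos.2 hy; linarith) h1
      have hb' := mul_le_mul_of_nonneg_left hb (Real.rpow_nonneg hy.le q)
      have e1 : y ^ q * (1 + (y⁻¹ - 1)) ^ q = 1 := by
        rw [add_sub_cancel, ← Real.mul_rpow hy.le (inv_pos.2 hy).le, mul_inv_cancel₀ hy.ne',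
          Real.one_rpow]
      have e2 : y ^ q = y ^ (q - 1) * y := by
        rw [← Real.rpow_add_one hy.ne', sub_add_cancel]
      rw [e1] at hb'
      have e3 : y ^ q * (q * (y⁻¹ - 1)) = q * y ^ (q - 1) * (1 - y) := by
        rw [e2]; field_simp
      nlinarith
    have mono : (y ^ (q - 1) - 1) * (y - 1) ≤ (y ^ n - 1) * (y - 1) := by
      rcases le_total 1 y with h | h
      · have : y ^ (q - 1) ≤ y ^ n := by
          rw [← Real.rpow_natCast]; exact Real.rpow_le_rpow_of_exponent_le h hn
        exact mul_le_mul_of_nonneg_right (by linarith) (by linarith)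
      · have : y ^ n ≤ y ^ (q - 1) := by
          rw [← Real.rpow_natCast]; exact Real.rpow_le_rpow_of_exponent_ge hy h hn
        exact mul_le_mul_of_nonpos_right (by linarith) (by linarith)
    have geom : (y ^ n - 1) * (y - 1) ≤ (∑ i ∈ Finset.range n, |R| ^ i) * (y - 1) ^ 2 := by
      rw [← geom_sum_mul, mul_assoc, ← sq]
      gcongr with i _
      exact hyR.trans (le_abs_self R)
    nlinarith [mul_le_mul_of_nonneg_left (mono.trans geom) hq.le]

theorem rpow_sub_two_mul_sq {p t : ℝ} (hp : 1 < p) (ht : 0 ≤ t) : t ^ (p - 2) * t ^ 2 = t ^ p := by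
  rcases ht.eq_or_lt with rfl | ht
  · rw [Real.zero_rpow (by linarith : p ≠ 0)]; simp
  · rw [← Real.rpow_add_natCast ht.ne']; norm_num

/-- Quadratic upper bound for the Bregman distance of `a ↦ ‖a‖ ^ p`. -/
theorem exists_norm_add_rpow_sub_le (p : ℝ) (hp : 1 < p) :
    ∃ C : ℝ, 0 < C ∧ ∀ {E : Type} [NormedAddCommGroup E] [InnerProductSpace ℝ E] (a b : E),
      ‖a + b‖ ^ p - ‖a‖ ^ p - p * (‖a‖ ^ (p - 2) * ⟪a, b⟫) ≤
        C * (‖b‖ ^ 2 * (‖a‖ + ‖b‖) ^ (p - 2)) := by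
  obtain ⟨M, hM, hMy⟩ := exists_rpow_le_one_add_mul_add_sq (p / 2) (by linarith) (9 / 4)
  refine ⟨9 * (1 + p) + 9 / 4 * (p / 2 + M * (25 / 4)), by positivity, ?_⟩
  intro E _ _ a b
  have hA := norm_nonneg a
  have hB := norm_nonneg b
  have hin := abs_le.1 (abs_real_inner_le_norm a b)
  have split : ∀ t : ℝ, 0 ≤ t → t ^ p = t ^ (p - 2) * t ^ 2 := fun t ht =>
    (rpow_sub_two_mul_sq hp ht).symm
  have hsum := split (‖a‖ + ‖b‖) (by positivity)
  have hmono : ‖a‖ ^ p ≤ (‖a‖ + ‖b‖) ^ p := Real.rpow_le_rpow hA (by linarith) (by linarith)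
  have hR : 0 ≤ (‖a‖ + ‖b‖) ^ (p - 2) := by positivity
  set R := (‖a‖ + ‖b‖) ^ (p - 2) with hRdef
  have hP : 0 ≤ ‖a‖ ^ (p - 2) := by positivity
  set P := ‖a‖ ^ (p - 2) with hPdef
  rcases le_or_gt ‖a‖ (2 * ‖b‖) with h | h
  · have h1 : ‖a + b‖ ^ p ≤ R * (‖a‖ + ‖b‖) ^ 2 := by
      rw [← hsum]
      exact Real.rpow_le_rpow (norm_nonneg _) (norm_add_le a b) (by linarith)
    have h2 : -(P * ⟪a, b⟫) ≤ R * (‖a‖ + ‖b‖) ^ 2 := by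
      rcases hA.eq_or_lt with h0 | h0
      · have : a = 0 := norm_eq_zero.1 h0.symm
        rw [this, inner_zero_left]; simp only [mul_zero, neg_zero]; positivity
      have e1 : P * ‖a‖ = ‖a‖ ^ (p - 1) := by
        rw [hPdef, ← Real.rpow_add_one h0.ne']; congr 1; ring
      have e2 : (‖a‖ + ‖b‖) ^ p = (‖a‖ + ‖b‖) ^ (p - 1) * (‖a‖ + ‖b‖) := by
        rw [← Real.rpow_add_one (by positivity)]; congr 1; ring
      rw [← hsum, e2]
      calc -(P * ⟪a, b⟫) ≤ P * ‖a‖ * ‖b‖ := by nlinarith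
        _ = ‖a‖ ^ (p - 1) * ‖b‖ := by rw [e1]
        _ ≤ _ := by
          gcongr
          · linarith
          · linarith
    have h3 : (‖a‖ + ‖b‖) ^ 2 ≤ 9 * ‖b‖ ^ 2 := by nlinarith
    have h4 : R * (‖a‖ + ‖b‖) ^ 2 ≤ 9 * (‖b‖ ^ 2 * R) := by nlinarith
    have h5 : 0 ≤ ‖a‖ ^ p := by positivity
    have h6 : 0 ≤ ‖b‖ ^ 2 * R := by positivity
    have h7 := mul_le_mul_of_nonneg_left (h2.trans h4) (by linarith : (0:ℝ) ≤ p)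
    have h8 : 0 ≤ 9 / 4 * (p / 2 + M * (25 / 4)) * (‖b‖ ^ 2 * R) := by positivity
    linarith
  · have ha : 0 < ‖a‖ := by linarith
    have hlow : ‖a‖ / 2 < ‖a + b‖ := by
      have := norm_sub_le (a + b) b
      rw [add_sub_cancel_right] at this
      linarith
    have hup : ‖a + b‖ ≤ 3 / 2 * ‖a‖ := (norm_add_le a b).trans (by linarith)
    set y := ‖a + b‖ ^ 2 / ‖a‖ ^ 2 with hy
    have hy0 : 0 < y := by
      have : 0 < ‖a + b‖ := by linarith
      positivity
    have hy1 : y ≤ 9 / 4 := by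
      rw [hy, div_le_iff₀ (by positivity)]
      nlinarith [norm_nonneg (a + b)]
    have hexp := norm_add_sq_real a b
    have hy2 : (y - 1) * ‖a‖ ^ 2 = 2 * ⟪a, b⟫ + ‖b‖ ^ 2 := by
      rw [hy]; field_simp; linarith
    have hyp : ‖a + b‖ ^ p = ‖a‖ ^ p * y ^ (p / 2) := by
      rw [hy, Real.div_rpow (by positivity) (by positivity), ← Real.rpow_natCast,
        ← Real.rpow_natCast, ← Real.rpow_mul (norm_nonneg _), ← Real.rpow_mul (norm_nonneg _)]
      have : ((2 : ℕ) : ℝ) * (p / 2) = p := by push_cast; ring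
      rw [this]; field_simp
    have hbound := mul_le_mul_of_nonneg_left (hMy y hy0 hy1) (Real.rpow_nonneg hA p)
    rw [← hyp, split _ hA, ← hPdef] at hbound
    have hsq : ‖a‖ ^ 2 * (y - 1) ^ 2 ≤ 25 / 4 * ‖b‖ ^ 2 := by
      have h1 : |(y - 1) * ‖a‖ ^ 2| ≤ 5 / 2 * ‖a‖ * ‖b‖ := by
        have hbb : ‖b‖ ^ 2 ≤ ‖a‖ * ‖b‖ / 2 := by
          have := mul_le_mul_of_nonneg_right h.le hB
          linarith
        have hab : 0 ≤ ‖a‖ * ‖b‖ := by positivity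
        have hbs : 0 ≤ ‖b‖ ^ 2 := by positivity
        rw [hy2, abs_le]; constructor <;> linarith
      have h2 := sq_le_sq' (abs_le.1 h1).1 (abs_le.1 h1).2
      have h3 : ‖a‖ ^ 2 * (‖a‖ ^ 2 * (y - 1) ^ 2) ≤ ‖a‖ ^ 2 * (25 / 4 * ‖b‖ ^ 2) := by linarith
      exact le_of_mul_le_mul_left h3 (by positivity)
    have hPR : P ≤ 9 / 4 * R := by
      rw [split _ hA, hsum, ← hPdef] at hmono
      have h3 : (‖a‖ + ‖b‖) ^ 2 ≤ 9 / 4 * ‖a‖ ^ 2 := by nlinarith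
      have h4 : ‖a‖ ^ 2 * P ≤ ‖a‖ ^ 2 * (9 / 4 * R) := by
        have := mul_le_mul_of_nonneg_left h3 hR
        linarith
      exact le_of_mul_le_mul_left h4 (by positivity)
    have key : ‖a + b‖ ^ p - P * ‖a‖ ^ 2 - p * (P * ⟪a, b⟫) ≤
        P * ((p / 2 + M * (25 / 4)) * ‖b‖ ^ 2) := by
      have e : P * ‖a‖ ^ 2 * (1 + p / 2 * (y - 1) + M * (y - 1) ^ 2) =
          P * (‖a‖ ^ 2 + p / 2 * ((y - 1) * ‖a‖ ^ 2) + M * (‖a‖ ^ 2 * (y - 1) ^ 2)) := by ring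
      rw [e, hy2] at hbound
      have h5 := mul_le_mul_of_nonneg_left (mul_le_mul_of_nonneg_left hsq hM) hP
      linarith
    rw [split _ hA, ← hPdef]
    refine key.trans ((mul_le_mul_of_nonneg_right hPR (by positivity)).trans ?_)
    have h6 : 0 ≤ 9 * (1 + p) * (‖b‖ ^ 2 * R) := by positivity
    linarith

theorem norm_gradient_sub_gradient {d : ℕ} (f g : Ed d → ℝ) (x : Ed d) :
    ‖gradient f x - gradient g x‖ = ‖fderiv ℝ f x - fderiv ℝ g x‖ := by
  rw [gradient, gradient, ← map_sub, LinearIsometryEquiv.norm_map]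

/-- Nonnegative `C¹` functions with compact support in an open set are `C¹`-limits of nonnegative
test functions supported in a common compact set. -/
theorem exists_isTestFun_approx {d : ℕ} {Ω : Set (Ed d)} (hΩ : IsOpen Ω) {φ : Ed d → ℝ}
    (hφ : ContDiff ℝ 1 φ) (hc : HasCompactSupport φ) (hs : tsupport φ ⊆ Ω) (h0 : ∀ x, 0 ≤ φ x) :
    ∃ K : Set (Ed d), IsCompact K ∧ K ⊆ Ω ∧ tsupport φ ⊆ K ∧ ∀ ε : ℝ, 0 < ε →
      ∃ ψ : Ed d → ℝ, IsTestFun Ω ψ ∧ (∀ x, 0 ≤ ψ x) ∧ tsupport ψ ⊆ K ∧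
        ∀ x, |ψ x - φ x| ≤ ε ∧ ‖gradient ψ x - gradient φ x‖ ≤ ε := by
  obtain ⟨δ, hδ, hδΩ⟩ := hc.isCompact.exists_cthickening_subset_open hΩ hs
  refine ⟨cthickening δ (tsupport φ), hc.isCompact.cthickening, hδΩ, self_subset_cthickening _, ?_⟩
  intro ε hε
  have hφ' : Continuous (fderiv ℝ φ) := hφ.continuous_fderiv one_ne_zero
  have u1 := hc.uniformContinuous_of_continuous hφ.continuous
  have u2 := (hc.fderiv ℝ).uniformContinuous_of_continuous hφ'
  obtain ⟨r1, hr1, H1⟩ := Metric.uniformContinuous_iff.1 u1 ε hε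
  obtain ⟨r2, hr2, H2⟩ := Metric.uniformContinuous_iff.1 u2 ε hε
  set r := min δ (min r1 r2)
  have hr0 : 0 < r := by positivity
  let χ : ContDiffBump (0 : Ed d) := ⟨r / 2, r, by positivity, by linarith⟩
  set ψ : Ed d → ℝ := convolution (χ.normed volume) φ (ContinuousLinearMap.lsmul ℝ ℝ) volume
  have hsupp : tsupport ψ ⊆ cthickening δ (tsupport φ) := by
    refine closure_minimal ?_ isClosed_cthickening
    refine (support_convolution_subset _).trans ?_
    rw [χ.support_normed_eq]
    rintro _ ⟨y, hy, z, hz, rfl⟩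
    refine mem_cthickening_of_dist_le _ z _ _ (subset_tsupport _ hz) ?_
    rw [mem_ball, dist_zero_right] at hy
    have : r ≤ δ := min_le_left _ _
    simp only [dist_eq_norm, add_sub_cancel_right]
    exact hy.le.trans this
  have hcs : HasCompactSupport ψ :=
    hc.isCompact.cthickening.of_isClosed_subset (isClosed_tsupport _) hsupp
  refine ⟨ψ, ⟨?_, hcs, hsupp.trans hδΩ⟩, ?_, hsupp, ?_⟩
  · exact (χ.hasCompactSupport_normed (μ := volume)).contDiff_convolution_left _ χ.contDiff_normed
      hφ.continuous.locallyIntegrable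
  · intro x
    exact integral_nonneg fun t => mul_nonneg (χ.nonneg_normed t) (h0 _)
  · intro x
    constructor
    · refine χ.dist_normed_convolution_le hφ.continuous.aestronglyMeasurable fun y hy => ?_
      refine (H1 (lt_of_lt_of_le (mem_ball.1 hy) ?_)).le
      exact (min_le_right _ _).trans (min_le_left _ _)
    · have hd := hc.hasFDerivAt_convolution_right (μ := volume) (ContinuousLinearMap.lsmul ℝ ℝ)
        (χ.continuous_normed (μ := volume)).locallyIntegrable hφ x
      have he : convolution (χ.normed volume) (fderiv ℝ φ)
          ((ContinuousLinearMap.lsmul ℝ ℝ).precompR (Ed d)) volume =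
          convolution (χ.normed volume) (fderiv ℝ φ) (ContinuousLinearMap.lsmul ℝ ℝ) volume := by
        ext1 y
        rfl
      rw [norm_gradient_sub_gradient, hd.fderiv, he, ← dist_eq_norm]
      refine χ.dist_normed_convolution_le hφ'.aestronglyMeasurable fun y hy => ?_
      refine (H2 (lt_of_lt_of_le (mem_ball.1 hy) ?_)).le
      exact (min_le_right _ _).trans (min_le_right _ _)

/-- A first-order linear functional with locally integrable coefficients that is nonpositive on
nonnegative test functions is nonpositive on nonnegative compactly supported `C¹` functions. -/
theorem setIntegral_inner_gradient_add_le_zero {d : ℕ} {Ω : Set (Ed d)} (hΩ : IsOpen Ω)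
    {A : Ed d → Ed d} {B : Ed d → ℝ}
    (hA : ∀ K ⊆ Ω, IsCompact K → IntegrableOn A K) (hB : ∀ K ⊆ Ω, IsCompact K → IntegrableOn B K)
    (h : ∀ ψ : Ed d → ℝ, IsTestFun Ω ψ → (∀ x, 0 ≤ ψ x) →
      ∫ x in Ω, (⟪A x, gradient ψ x⟫ + B x * ψ x) ≤ 0)
    {φ : Ed d → ℝ} (hφ : ContDiff ℝ 1 φ) (hc : HasCompactSupport φ) (hs : tsupport φ ⊆ Ω)
    (h0 : ∀ x, 0 ≤ φ x) :
    IntegrableOn (fun x => ⟪A x, gradient φ x⟫ + B x * φ x) Ω ∧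
      ∫ x in Ω, (⟪A x, gradient φ x⟫ + B x * φ x) ≤ 0 := by
  obtain ⟨K, hK, hKΩ, hφK, happ⟩ := exists_isTestFun_approx hΩ hφ hc hs h0
  have hAK := hA K hKΩ hK
  have hBK := hB K hKΩ hK
  have zero : ∀ f : Ed d → ℝ, tsupport f ⊆ K → ∀ x ∈ Ω \ K,
      ⟪A x, gradient f x⟫ + B x * f x = 0 := by
    intro f hf x hx
    have hx' : x ∉ tsupport f := fun h => hx.2 (hf h)
    rw [gradient_eq_zero_of_notMem_tsupport hx', image_eq_zero_of_notMem_tsupport hx']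
    simp
  have int : ∀ f : Ed d → ℝ, ContDiff ℝ 1 f → HasCompactSupport f →
      IntegrableOn (fun x => ⟪A x, gradient f x⟫ + B x * f x) K := by
    intro f hf hfc
    have hg : Continuous (gradient f) :=
      (InnerProductSpace.toDual ℝ (Ed d)).symm.continuous.comp (hf.continuous_fderiv one_ne_zero)
    have hgc : HasCompactSupport (gradient f) :=
      (hfc.fderiv ℝ).comp_left (g := (InnerProductSpace.toDual ℝ (Ed d)).symm) (map_zero _)
    obtain ⟨c1, hc1⟩ := hg.bounded_above_of_compact_support hgc
    obtain ⟨c2, hc2⟩ := hf.continuous.bounded_above_of_compact_support hfc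
    refine Integrable.add ?_ (hBK.mul_bdd hf.continuous.aestronglyMeasurable (.of_forall hc2))
    refine (hAK.norm.const_mul c1).mono' (hAK.1.inner hg.aestronglyMeasurable)
      (.of_forall fun x => ?_)
    refine (norm_inner_le_norm _ _).trans ?_
    rw [mul_comm]
    exact mul_le_mul_of_nonneg_right (hc1 x) (norm_nonneg _)
  have hφint := int φ hφ hc
  refine ⟨hφint.of_forall_sdiff_eq_zero hΩ.measurableSet (zero φ hφK), ?_⟩
  rw [setIntegral_eq_of_subset_of_forall_sdiff_eq_zero hΩ.measurableSet hKΩ (zero φ hφK)]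
  set M := ∫ x in K, (‖A x‖ + ‖B x‖)
  have hM0 : 0 ≤ M := integral_nonneg fun x => by positivity
  refine le_of_forall_pos_le_add fun ε hε => ?_
  obtain ⟨ψ, hψ, hψ0, hψK, hψφ⟩ := happ (ε / (M + 1)) (by positivity)
  have hψle := h ψ hψ hψ0
  rw [setIntegral_eq_of_subset_of_forall_sdiff_eq_zero hΩ.measurableSet hKΩ (zero ψ hψK)] at hψle
  have hψint := int ψ (hψ.1.of_le (by exact_mod_cast le_top)) hψ.2.1
  have hMint : IntegrableOn (fun x => ε / (M + 1) * (‖A x‖ + ‖B x‖)) K :=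
    (hAK.norm.add hBK.norm).const_mul _
  calc ∫ x in K, (⟪A x, gradient φ x⟫ + B x * φ x)
      ≤ ∫ x in K, ((⟪A x, gradient ψ x⟫ + B x * ψ x) + ε / (M + 1) * (‖A x‖ + ‖B x‖)) := by
        refine integral_mono hφint (hψint.add hMint) fun x => ?_
        have h1 : ⟪A x, gradient φ x⟫ - ⟪A x, gradient ψ x⟫ ≤ ‖A x‖ * (ε / (M + 1)) := by
          rw [← inner_sub_right]
          refine (real_inner_le_norm _ _).trans ?_
          rw [norm_sub_rev]
          exact mul_le_mul_of_nonneg_left (hψφ x).2 (norm_nonneg _)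
        have h2 : B x * φ x - B x * ψ x ≤ ‖B x‖ * (ε / (M + 1)) := by
          rw [← mul_sub]
          refine (le_abs_self _).trans ?_
          rw [abs_mul, abs_sub_comm]
          exact mul_le_mul_of_nonneg_left (hψφ x).1 (abs_nonneg _)
        dsimp only
        linarith
    _ = (∫ x in K, (⟪A x, gradient ψ x⟫ + B x * ψ x)) + ε / (M + 1) * M := by
        rw [integral_add hψint hMint, integral_const_mul]
    _ ≤ 0 + ε := by
        have : ε / (M + 1) * M ≤ ε := by
          rw [div_mul_eq_mul_div, div_le_iff₀ (by positivity)]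
          nlinarith
        linarith

theorem gradient_eq_smul_add_smul {d : ℕ} {f g h : Ed d → ℝ} {x : Ed d} {a b : ℝ}
    (hf : HasFDerivAt f (a • fderiv ℝ g x + b • fderiv ℝ h x) x) :
    gradient f x = a • gradient g x + b • gradient h x := by
  rw [gradient, hf.fderiv]
  simp [gradient]

theorem rpow_sub_two_mul_self {p t : ℝ} (hp : 1 < p) (ht : 0 ≤ t) :
    t ^ (p - 2) * t = t ^ (p - 1) := by
  rcases ht.eq_or_lt with rfl | ht
  · rw [Real.zero_rpow (by linarith : p - 1 ≠ 0)]; simp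
  · rw [← Real.rpow_add_one ht.ne']; congr 1; ring

theorem sq_mul_add_rpow_le_rpow {p s t : ℝ} (hp : 1 < p) (hp2 : p ≤ 2) (hs : 0 ≤ s) (ht : 0 ≤ t) :
    t ^ 2 * (s + t) ^ (p - 2) ≤ t ^ p := by
  rcases ht.eq_or_lt with rfl | ht'
  · rw [Real.zero_rpow (by linarith : p ≠ 0)]; simp
  · rw [← rpow_sub_two_mul_sq hp ht, mul_comm]
    exact mul_le_mul_of_nonneg_right
      (Real.rpow_le_rpow_of_nonpos ht' (by linarith) (by linarith)) (by positivity)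

theorem add_rpow_le_two_rpow_mul {r s t : ℝ} (hr : 0 ≤ r) (hs : 0 ≤ s) (ht : 0 ≤ t) :
    (s + t) ^ r ≤ 2 ^ r * (s ^ r + t ^ r) := by
  have h1 : (s + t) ^ r ≤ (2 * max s t) ^ r :=
    Real.rpow_le_rpow (by positivity) (by linarith [le_max_left s t, le_max_right s t]) hr
  rw [Real.mul_rpow (by norm_num) (by positivity)] at h1
  refine h1.trans (mul_le_mul_of_nonneg_left ?_ (by positivity))
  have hs' : 0 ≤ s ^ r := by positivity
  have ht' : 0 ≤ t ^ r := by positivity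
  rcases max_choice s t with h | h <;> rw [h] <;> linarith

theorem integrableOn_of_continuousOn_of_eq_zero {d : ℕ} {Ω K : Set (Ed d)} (hΩ : IsOpen Ω)
    (hK : IsCompact K) (hKΩ : K ⊆ Ω) {F : Ed d → ℝ} (hF : ContinuousOn F Ω)
    (h0 : ∀ x, x ∉ K → F x = 0) : IntegrableOn F Ω :=
  ((hF.mono hKΩ).integrableOn_compact hK).of_forall_sdiff_eq_zero hΩ.measurableSet
    fun x hx => h0 x hx.2

theorem LinfLoc.integrableOn_mul {d : ℕ} {Ω K : Set (Ed d)} {V F : Ed d → ℝ} (hV : LinfLoc Ω V)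
    (hK : IsCompact K) (hKΩ : K ⊆ Ω) (hF : IntegrableOn F K) :
    IntegrableOn (fun x => V x * F x) K := by
  obtain ⟨c, hc⟩ := hV.2 K hK hKΩ
  exact Integrable.bdd_mul hF hV.1.aestronglyMeasurable
    ((ae_restrict_iff' hK.measurableSet).2 (.of_forall hc))

theorem measurable_gradient {d : ℕ} (f : Ed d → ℝ) : Measurable (gradient f) :=
  (InnerProductSpace.toDual ℝ (Ed d)).symm.continuous.measurable.comp (measurable_fderiv ℝ f)

/-- Testing the subsolution inequality with `v * w ^ p` and the quadratic bound for the Bregman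
distance of `a ↦ ‖a‖ ^ p` control the energy of `v * w`. -/
theorem IsSubsolution.Qf_mul_le {d : ℕ} {p C : ℝ} (hp : 1 < p)
    (hC : ∀ a b : Ed d, ‖a + b‖ ^ p - ‖a‖ ^ p - p * (‖a‖ ^ (p - 2) * ⟪a, b⟫) ≤
      C * (‖b‖ ^ 2 * (‖a‖ + ‖b‖) ^ (p - 2)))
    {Ω : Set (Ed d)} (hΩ : IsOpen Ω) {V v w : Ed d → ℝ} (hV : LinfLoc Ω V)
    (hv : ContDiffOn ℝ 1 v Ω) (hv0 : ∀ x ∈ Ω, 0 ≤ v x) (hsub : IsSubsolution p V Ω v)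
    (hw : ContDiff ℝ 1 w) (hwc : HasCompactSupport w) (hwΩ : tsupport w ⊆ Ω) (hw0 : ∀ x, 0 ≤ w x)
    (hG : IntegrableOn (fun x => (v x) ^ 2 * ‖gradient w x‖ ^ 2 *
      (w x * ‖gradient v x‖ + v x * ‖gradient w x‖) ^ (p - 2)) Ω) :
    Qf p V Ω (fun x => v x * w x) ≤ 1 / p * (C * ∫ x in Ω, (v x) ^ 2 * ‖gradient w x‖ ^ 2 *
      (w x * ‖gradient v x‖ + v x * ‖gradient w x‖) ^ (p - 2)) := by
  have hpp : 0 < p := by linarith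
  have hvd : ∀ x ∈ Ω, DifferentiableAt ℝ v x := fun x hx =>
    (hv.contDiffAt (hΩ.mem_nhds hx)).differentiableAt one_ne_zero
  have hwd : ∀ x, DifferentiableAt ℝ w x := fun x => hw.differentiable one_ne_zero x
  have hgv : ContinuousOn (gradient v) Ω :=
    (InnerProductSpace.toDual ℝ (Ed d)).symm.continuous.comp_continuousOn
      (hv.continuousOn_fderiv_of_isOpen hΩ le_rfl)
  have hgw : Continuous (gradient w) :=
    (InnerProductSpace.toDual ℝ (Ed d)).symm.continuous.comp (hw.continuous_fderiv one_ne_zero)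
  have hw_zero : ∀ x, x ∉ tsupport w → w x = 0 := fun x hx => image_eq_zero_of_notMem_tsupport hx
  set φ : Ed d → ℝ := fun x => v x * w x ^ p with hφdef
  have hφsupp : tsupport φ ⊆ tsupport w := by
    refine closure_mono fun x hx hx' => hx ?_
    simp [hφdef, hx', Real.zero_rpow hpp.ne']
  have hwp : ContDiff ℝ 1 fun x => w x ^ p := hw.rpow_const_of_le (by exact_mod_cast hp.le)
  have hφ : ContDiff ℝ 1 φ := by
    refine contDiff_iff_contDiffAt.2 fun x => ?_
    by_cases hx : x ∈ tsupport φ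
    · exact (hv.contDiffAt (hΩ.mem_nhds (hwΩ (hφsupp hx)))).mul hwp.contDiffAt
    · exact contDiffAt_const.congr_of_eventuallyEq (notMem_tsupport_iff_eventuallyEq.1 hx)
  have hφc : HasCompactSupport φ := hwc.isCompact.of_isClosed_subset (isClosed_tsupport _) hφsupp
  have hφ0 : ∀ x, 0 ≤ φ x := fun x => by
    by_cases hx : x ∈ tsupport w
    · exact mul_nonneg (hv0 x (hwΩ hx)) (Real.rpow_nonneg (hw0 x) p)
    · simp [hφdef, hw_zero x hx, Real.zero_rpow hpp.ne']
  have hgφ : ∀ x ∈ Ω, gradient φ x =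
      (w x ^ p) • gradient v x + (v x * (p * w x ^ (p - 1))) • gradient w x := fun x hx => by
    refine gradient_eq_smul_add_smul ?_
    have h1 := (hvd x hx).hasFDerivAt.mul
      ((hwd x).hasFDerivAt.rpow_const (p := p) (Or.inr hp.le))
    rw [smul_smul, add_comm] at h1
    exact h1
  have hgvw : ∀ x ∈ Ω, gradient (fun x => v x * w x) x = w x • gradient v x + v x • gradient w x :=
    fun x hx => by
      refine gradient_eq_smul_add_smul ?_
      have h1 := (hvd x hx).hasFDerivAt.mul (hwd x).hasFDerivAt
      rw [add_comm] at h1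
      exact h1
  obtain ⟨hint, hle⟩ := setIntegral_inner_gradient_add_le_zero hΩ
    (A := fun x => ‖gradient v x‖ ^ (p - 2) • gradient v x)
    (B := fun x => V x * (|v x| ^ (p - 2) * v x))
    (by
      intro K hKΩ hK
      have hcont : ContinuousOn (fun x => ‖gradient v x‖ ^ (p - 1)) K :=
        (hgv.mono hKΩ).norm.rpow_const fun x _ => Or.inr (by linarith)
      refine (hcont.integrableOn_compact hK).mono' ?_ (.of_forall fun x => ?_)
      · exact (((measurable_gradient v).norm.pow_const _).smul
          (measurable_gradient v)).aestronglyMeasurable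
      · rw [norm_smul, Real.norm_of_nonneg (by positivity), rpow_sub_two_mul_self hp (norm_nonneg _)])
    (by
      intro K hKΩ hK
      refine hV.integrableOn_mul hK hKΩ ?_
      have hvK := hv.continuousOn.mono hKΩ
      have hcont : ContinuousOn (fun x => |v x| ^ (p - 1)) K :=
        hvK.abs.rpow_const fun x _ => Or.inr (by linarith)
      have hm := hvK.aemeasurable (μ := volume) hK.measurableSet
      refine (hcont.integrableOn_compact hK).mono' ?_ (.of_forall fun x => ?_)
      · exact ((hm.abs.pow_const _).mul hm).aestronglyMeasurable
      · rw [norm_mul, Real.norm_of_nonneg (by positivity), Real.norm_eq_abs,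
          rpow_sub_two_mul_self hp (abs_nonneg _)])
    (by
      intro ψ hψ hψ0
      refine le_of_eq_of_le (integral_congr_ae (.of_forall fun x => ?_)) (hsub ψ hψ hψ0)
      simp only [real_inner_smul_left]
      ring)
    hφ hφc (hφsupp.trans hwΩ) hφ0
  have hF : IntegrableOn (fun x => ‖gradient (fun x => v x * w x) x‖ ^ p +
      V x * |v x * w x| ^ p) Ω := by
    refine Integrable.add ?_ ?_
    · have hcont : ContinuousOn (fun x => ‖w x • gradient v x + v x • gradient w x‖ ^ p) Ω :=
        ((hw.continuous.continuousOn.smul hgv).add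
          (hv.continuousOn.smul hgw.continuousOn)).norm.rpow_const fun x _ => Or.inr hpp.le
      refine (integrableOn_of_continuousOn_of_eq_zero hΩ hwc.isCompact hwΩ hcont
        fun x hx => ?_).congr_fun (fun x hx => ?_) hΩ.measurableSet
      · simp [hw_zero x hx, gradient_eq_zero_of_notMem_tsupport hx, Real.zero_rpow hpp.ne']
      · simp only [hgvw x hx]
    · have hcont : ContinuousOn (fun x => |v x * w x| ^ p) (tsupport w) :=
        (((hv.continuousOn.mono hwΩ).mul hw.continuous.continuousOn).abs).rpow_const
          fun x _ => Or.inr hpp.le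
      refine (hV.integrableOn_mul hwc.isCompact hwΩ
        (hcont.integrableOn_compact hwc.isCompact)).of_forall_sdiff_eq_zero hΩ.measurableSet ?_
      intro x hx
      simp [hw_zero x hx.2, Real.zero_rpow hpp.ne']
  rw [Qf]
  refine mul_le_mul_of_nonneg_left ?_ (by positivity)
  rw [← integral_const_mul]
  refine le_trans (setIntegral_mono_on hF (hint.add (hG.const_mul C)) hΩ.measurableSet
    fun x hx => ?_) ((integral_add hint (hG.const_mul C)).trans_le (by linarith))
  have hvx := hv0 x hx
  have hwx := hw0 x
  have key := hC (w x • gradient v x) (v x • gradient w x)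
  rw [hgvw x hx, Pi.add_apply, hgφ x hx]
  simp only [real_inner_smul_left, inner_add_right, real_inner_smul_right, real_inner_self_eq_norm_sq,
    hφdef]
  simp only [real_inner_smul_left, real_inner_smul_right, norm_smul (w x) (gradient v x),
    norm_smul (v x) (gradient w x), Real.norm_of_nonneg hvx, Real.norm_of_nonneg hwx,
    Real.mul_rpow hwx (norm_nonneg (gradient v x)), mul_pow] at key
  rw [abs_of_nonneg hvx, abs_of_nonneg (mul_nonneg hvx hwx), Real.mul_rpow hvx hwx,
    ← rpow_sub_two_mul_self hp hwx, ← rpow_sub_two_mul_sq hp hvx]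
  rw [← rpow_sub_two_mul_sq hp (norm_nonneg (gradient v x))] at key
  linarith

theorem statement_4 (p : ℝ) (hp : 1 < p) :
    ∃ C : ℝ, 0 < C ∧
      ∀ (d : ℕ), 2 ≤ d →
      ∀ Ω : Set (Ed d), IsOpen Ω → IsConnected Ω →
      ∀ V : Ed d → ℝ, LinfLoc Ω V →
      ∀ v : Ed d → ℝ, ContDiffOn ℝ 1 v Ω → (∀ x ∈ Ω, 0 ≤ v x) → IsSubsolution p V Ω v →
      ∀ w : Ed d → ℝ, ContDiff ℝ 1 w → HasCompactSupport w → tsupport w ⊆ Ω →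
        (∀ x, 0 ≤ w x) →
        Qf p V Ω (fun x => v x * w x) ≤
            C * ∫ x in Ω ∩ {x | 0 < v x}, (v x) ^ (2 : ℝ) * ‖gradient w x‖ ^ (2 : ℝ) *
              (w x * ‖gradient v x‖ + v x * ‖gradient w x‖) ^ (p - 2) ∧
        (2 ≤ p →
          Qf p V Ω (fun x => v x * w x) ≤
            C * ∫ x in Ω, ((v x) ^ p * ‖gradient w x‖ ^ p +
              (v x) ^ (2 : ℝ) * ‖gradient v x‖ ^ (p - 2) * (w x) ^ (p - 2) *
                ‖gradient w x‖ ^ (2 : ℝ))) := by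
  obtain ⟨C, hC0, hC⟩ := exists_norm_add_rpow_sub_le p hp
  refine ⟨C * (1 + 2 ^ (p - 2)), by positivity, ?_⟩
  intro d _ Ω hΩ _ V hV v hv hv0 hsub w hw hwc hwΩ hw0
  have hpp : 0 < p := by linarith
  have hgv : ContinuousOn (gradient v) Ω :=
    (InnerProductSpace.toDual ℝ (Ed d)).symm.continuous.comp_continuousOn
      (hv.continuousOn_fderiv_of_isOpen hΩ le_rfl)
  have hgw : Continuous (gradient w) :=
    (InnerProductSpace.toDual ℝ (Ed d)).symm.continuous.comp (hw.continuous_fderiv one_ne_zero)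
  simp only [Real.rpow_two]
  set G : Ed d → ℝ := fun x => (v x) ^ 2 * ‖gradient w x‖ ^ 2 *
    (w x * ‖gradient v x‖ + v x * ‖gradient w x‖) ^ (p - 2) with hGdef
  set H : Ed d → ℝ := fun x => (v x) ^ p * ‖gradient w x‖ ^ p +
    (v x) ^ 2 * ‖gradient v x‖ ^ (p - 2) * (w x) ^ (p - 2) * ‖gradient w x‖ ^ 2 with hHdef
  have hG0 : ∀ x ∈ Ω, 0 ≤ G x := fun x hx => by
    have := hv0 x hx
    have := hw0 x
    positivity
  have hGm : AEStronglyMeasurable G (volume.restrict Ω) := by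
    have h1 := hv.continuousOn.aemeasurable (μ := volume) hΩ.measurableSet
    have h2 := (measurable_gradient v).norm.aemeasurable (μ := volume.restrict Ω)
    have h3 := (measurable_gradient w).norm.aemeasurable (μ := volume.restrict Ω)
    have h4 := hw.continuous.measurable.aemeasurable (μ := volume.restrict Ω)
    exact (((h1.pow_const 2).mul (h3.pow_const 2)).mul
      (((h4.mul h2).add (h1.mul h3)).pow_const (p - 2))).aestronglyMeasurable
  have hH : 2 ≤ p → IntegrableOn H Ω := fun h2 => by
    refine integrableOn_of_continuousOn_of_eq_zero hΩ hwc.isCompact hwΩ ?_ fun x hx => ?_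
    · exact ((hv.continuousOn.rpow_const fun _ _ => Or.inr hpp.le).mul
        (hgw.norm.continuousOn.rpow_const fun _ _ => Or.inr hpp.le)).add
        ((((hv.continuousOn.pow 2).mul (hgv.norm.rpow_const fun _ _ => Or.inr (by linarith))).mul
        (hw.continuous.continuousOn.rpow_const fun _ _ => Or.inr (by linarith))).mul
        (hgw.norm.continuousOn.pow 2))
    · simp [hHdef, gradient_eq_zero_of_notMem_tsupport hx, Real.zero_rpow hpp.ne']
  have hGH : 2 ≤ p → ∀ x ∈ Ω, G x ≤ 2 ^ (p - 2) * H x := fun h2 x hx => by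
    have hvx := hv0 x hx
    have hwx := hw0 x
    have h := mul_le_mul_of_nonneg_left (add_rpow_le_two_rpow_mul (r := p - 2) (by linarith)
      (mul_nonneg hwx (norm_nonneg (gradient v x))) (mul_nonneg hvx (norm_nonneg (gradient w x))))
      (by positivity : 0 ≤ v x ^ 2 * ‖gradient w x‖ ^ 2)
    refine h.trans_eq ?_
    rw [Real.mul_rpow hwx (norm_nonneg _), Real.mul_rpow hvx (norm_nonneg _), hHdef]
    simp only [← rpow_sub_two_mul_sq hp hvx, ← rpow_sub_two_mul_sq hp (norm_nonneg (gradient w x))]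
    ring
  have hGint : IntegrableOn G Ω := by
    rcases le_total p 2 with h2 | h2
    · have hcont : ContinuousOn (fun x => (v x * ‖gradient w x‖) ^ p) Ω :=
        (hv.continuousOn.mul hgw.norm.continuousOn).rpow_const fun _ _ => Or.inr hpp.le
      refine (integrableOn_of_continuousOn_of_eq_zero hΩ hwc.isCompact hwΩ hcont
        fun x hx => ?_).mono' hGm ((ae_restrict_iff' hΩ.measurableSet).2 (.of_forall fun x hx => ?_))
      · simp [gradient_eq_zero_of_notMem_tsupport hx, Real.zero_rpow hpp.ne']
      · rw [Real.norm_of_nonneg (hG0 x hx), hGdef]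
        have h := sq_mul_add_rpow_le_rpow hp h2 (mul_nonneg (hw0 x) (norm_nonneg (gradient v x)))
          (mul_nonneg (hv0 x hx) (norm_nonneg (gradient w x)))
        rwa [mul_pow] at h
    · refine ((hH h2).const_mul (2 ^ (p - 2))).mono' hGm
        ((ae_restrict_iff' hΩ.measurableSet).2 (.of_forall fun x hx => ?_))
      rw [Real.norm_of_nonneg (hG0 x hx)]
      exact hGH h2 x hx
  have hQ := hsub.Qf_mul_le hp (fun a b => hC a b) hΩ hV hv hv0 hw hwc hwΩ hw0 hGint
  have hI0 : 0 ≤ ∫ x in Ω, G x := setIntegral_nonneg hΩ.measurableSet hG0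
  have hQ' : Qf p V Ω (fun x => v x * w x) ≤ C * ∫ x in Ω, G x := by
    refine hQ.trans (mul_le_of_le_one_left (by positivity) ?_)
    rw [div_le_one hpp]
    exact hp.le
  have h2p : (0 : ℝ) < 2 ^ (p - 2) := by positivity
  refine ⟨?_, fun h2 => ?_⟩
  · have hpos : ∫ x in Ω ∩ {x | 0 < v x}, G x = ∫ x in Ω, G x := by
      refine (setIntegral_eq_of_subset_of_forall_sdiff_eq_zero hΩ.measurableSet inter_subset_left
        fun x hx => ?_).symm
      have : v x = 0 := le_antisymm (not_lt.1 fun h => hx.2 ⟨hx.1, h⟩) (hv0 x hx.1)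
      simp [hGdef, this]
    rw [hpos]
    refine hQ'.trans (mul_le_mul_of_nonneg_right ?_ hI0)
    exact le_mul_of_one_le_right hC0.le (by linarith)
  · have hIle : ∫ x in Ω, G x ≤ 2 ^ (p - 2) * ∫ x in Ω, H x := by
      rw [← integral_const_mul]
      exact setIntegral_mono_on hGint ((hH h2).const_mul _) hΩ.measurableSet (hGH h2)
    have hJ0 : 0 ≤ ∫ x in Ω, H x := by
      refine setIntegral_nonneg hΩ.measurableSet fun x hx => ?_
      have := hv0 x hx
      have := hw0 x
      positivity
    calc _ ≤ C * ∫ x in Ω, G x := hQ'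
      _ ≤ C * (2 ^ (p - 2) * ∫ x in Ω, H x) := mul_le_mul_of_nonneg_left hIle hC0.le
      _ ≤ C * (1 + 2 ^ (p - 2)) * ∫ x in Ω, H x := by
        rw [← mul_assoc]
        exact mul_le_mul_of_nonneg_right
          (mul_le_mul_of_nonneg_left (by linarith) hC0.le) hJ0
end
end
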